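/- arXiv:1112.0647 — 2 statements merged into one kernel-verified Lean document; each statement's English description precedes it below -/
import Mathlib

section
/- Let μ be a complex number and n ≥ 1 an integer. Then b_{2n}(0,1,μ) · n · (n)_{n−1} · (μ/2+n+1)_{n−1} = (μ+2n−2) · (μ/2+2n−1)_{n−1} · (μ+2n+1)_{n−1} · b_{2n−1}(0,1,μ). (Equivalently, when the denominators are nonzero, b_{2n}(0,1)/b_{2n−1}(0,1) = (μ+2n−2) (μ/2+2n−1)_{n−1} (μ+2n+1)_{n−1} / ( n (n)_{n−1} (μ/2+n+1)_{n−1} ).) -/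
/-- Generalized binomial coefficient `C(x,k) = x(x-1)⋯(x-k+1)/k!` for complex `x`. -/
noncomputable def gbinom (x : ℂ) (k : ℕ) : ℂ :=
  (∏ i ∈ Finset.range k, (x - i)) / (k.factorial : ℂ)

/-- Pochhammer symbol `(x)_k = x(x+1)⋯(x+k-1)`. -/
noncomputable def poch (x : ℂ) (k : ℕ) : ℂ :=
  ∏ i ∈ Finset.range k, (x + i)
/-- `b_n(I,J,μ)`: determinant of the `n×n` matrix with rows indexed by
`i = I,…,n-1+I`, columns indexed by `j = J,…,n-1+J`, and entries
`-δ_{i,j} + C(μ+i+j-2, j)`. -/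
noncomputable def bdet (μ : ℂ) (n I J : ℕ) : ℂ :=
  Matrix.det (Matrix.of fun i j : Fin n =>
    (if I + i.1 = J + j.1 then (-1 : ℂ) else 0)
      + gbinom (μ + ((I + i.1 : ℕ) : ℂ) + ((J + j.1 : ℕ) : ℂ) - 2) (J + j.1))

/-- Reciprocal factorial on the integers, extended by zero to negative arguments. -/
noncomputable def recipFactorial (z : ℤ) : ℂ :=
  if 0 ≤ z then ((z.toNat.factorial : ℕ) : ℂ)⁻¹ else 0

lemma recipFactorial_natCast (m : ℕ) : recipFactorial (m : ℤ) = ((m.factorial : ℕ) : ℂ)⁻¹ := by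
  simp [recipFactorial]

lemma recipFactorial_of_neg {z : ℤ} (hz : z < 0) : recipFactorial z = 0 := by
  simp [recipFactorial, not_le.mpr hz]

lemma recipFactorial_zero : recipFactorial 0 = 1 := by
  simp [recipFactorial]

lemma recipFactorial_eq_mul_succ (z : ℤ) :
    recipFactorial z = ((z : ℂ) + 1) * recipFactorial (z + 1) := by
  rcases lt_trichotomy z (-1) with h | h | h
  · rw [recipFactorial_of_neg (by omega), recipFactorial_of_neg (by omega), mul_zero]
  · subst h
    simp [recipFactorial]
  · lift z to ℕ using by omega
    have h1 : ((z.factorial : ℕ) : ℂ) ≠ 0 := by exact_mod_cast z.factorial_ne_zero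
    have h2 : ((z : ℂ) + 1) ≠ 0 := by exact_mod_cast z.succ_ne_zero
    rw [recipFactorial_natCast, ← Nat.cast_succ, recipFactorial_natCast, Nat.factorial_succ]
    push_cast
    field_simp

lemma recipFactorial_of_add_one_eq {z z' : ℤ} (h : z + 1 = z') :
    recipFactorial z = (z' : ℂ) * recipFactorial z' := by
  subst h
  rw [recipFactorial_eq_mul_succ]
  push_cast
  ring

/-- Coefficient of `v ^ i`, `v = (1 - w) ^ 2 / w`, in the expansion of
`(1 - w) ^ j * (w ^ (b + 1) + (-1) ^ j / w ^ (b + 1 + j))`. -/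
noncomputable def symCoeff (b j i : ℕ) : ℂ :=
  (-1) ^ j * (2 * b + 2 + j) * ((b + i).factorial : ℕ) * recipFactorial (2 * i - j)
    * recipFactorial (b + 1 - i + j)

lemma symCoeff_succ_col (b j i : ℕ) :
    symCoeff b (j + 1) i = symCoeff b j i - symCoeff (b + 1) j i := by
  unfold symCoeff
  have e1 : b + 1 + i = (b + i) + 1 := by ring
  rw [e1, Nat.factorial_succ,
    recipFactorial_of_add_one_eq (z := 2 * (i : ℤ) - ((j + 1 : ℕ) : ℤ)) (z' := 2 * i - j)
      (by push_cast; ring),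
    recipFactorial_of_add_one_eq (z := (b : ℤ) + 1 - i + j) (z' := b + 2 - i + j) (by ring)]
  have e2 : ((b + 1 : ℕ) : ℤ) + 1 - i + j = b + 2 - i + j := by push_cast; ring
  have e3 : (b : ℤ) + 1 - i + ((j + 1 : ℕ) : ℤ) = b + 2 - i + j := by push_cast; ring
  rw [e2, e3]
  push_cast
  ring

lemma symCoeff_eq_zero {b j i : ℕ} (h : b + 1 + j < i) : symCoeff b j i = 0 := by
  unfold symCoeff
  rw [recipFactorial_of_neg (z := (b : ℤ) + 1 - i + j) (by omega), mul_zero]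

lemma symCoeff_zero_recurrence (b i : ℕ) :
    symCoeff (b + 2) 0 (i + 1)
      = symCoeff (b + 1) 0 i + 2 * symCoeff (b + 1) 0 (i + 1) - symCoeff b 0 (i + 1) := by
  unfold symCoeff
  have e1 : b + 2 + (i + 1) = (b + i + 1) + 1 + 1 := by ring
  have e2 : b + 1 + (i + 1) = (b + i + 1) + 1 := by ring
  have e3 : b + 1 + i = (b + i + 1) := by ring
  have e4 : b + (i + 1) = (b + i + 1) := by ring
  have c1 : ((b + 2 : ℕ) : ℤ) + 1 - ((i + 1 : ℕ) : ℤ) + ((0 : ℕ) : ℤ) = b + 2 - i := by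
    push_cast; ring
  have c2 : ((b + 1 : ℕ) : ℤ) + 1 - (i : ℤ) + ((0 : ℕ) : ℤ) = b + 2 - i := by push_cast; ring
  have c3 : ((b + 1 : ℕ) : ℤ) + 1 - ((i + 1 : ℕ) : ℤ) + ((0 : ℕ) : ℤ) = b + 1 - i := by
    push_cast; ring
  have c4 : (b : ℤ) + 1 - ((i + 1 : ℕ) : ℤ) + ((0 : ℕ) : ℤ) = b - i := by push_cast; ring
  have c5 : 2 * ((i + 1 : ℕ) : ℤ) - ((0 : ℕ) : ℤ) = 2 * i + 2 := by push_cast; ring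
  rw [e1, e2, e3, e4, c1, c2, c3, c4, c5,
    recipFactorial_of_add_one_eq (z := (b : ℤ) - i) (z' := b + 1 - i) (by ring),
    recipFactorial_of_add_one_eq (z := (b : ℤ) + 1 - i) (z' := b + 2 - i) (by ring),
    recipFactorial_of_add_one_eq (z := 2 * (i : ℤ) - ((0 : ℕ) : ℤ)) (z' := 2 * i + 1)
      (by push_cast; ring),
    recipFactorial_of_add_one_eq (z := 2 * (i : ℤ) + 1) (z' := 2 * i + 2) (by ring),
    Nat.factorial_succ (b + i + 1 + 1), Nat.factorial_succ (b + i + 1)]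
  push_cast
  ring

lemma symCoeff_zero_zero (b : ℕ) : symCoeff b 0 0 = 2 := by
  unfold symCoeff
  have h := recipFactorial_natCast (b + 1)
  push_cast at h
  have h1 : ((b.factorial : ℕ) : ℂ) ≠ 0 := by exact_mod_cast b.factorial_ne_zero
  have h2 : ((b : ℂ) + 1) ≠ 0 := by exact_mod_cast b.succ_ne_zero
  simp only [pow_zero, Nat.cast_zero, mul_zero, sub_zero, add_zero, recipFactorial_zero, h,
    Nat.factorial_succ]
  push_cast
  field_simp

section SymmetricExpansion

variable {R : Type*} [CommRing R] [Algebra ℂ R]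

lemma symmetric_expansion_of_le {w w' : R} {b j I I' : ℕ} (hI : b + 1 + j < I) (hI' : I ≤ I') :
    ∑ i ∈ Finset.range I', algebraMap ℂ R (symCoeff b j i) * ((1 - w) ^ 2 * w') ^ i
      = ∑ i ∈ Finset.range I, algebraMap ℂ R (symCoeff b j i) * ((1 - w) ^ 2 * w') ^ i := by
  symm
  apply Finset.sum_subset (Finset.range_mono hI')
  intro i _ hi
  rw [symCoeff_eq_zero (by simp at hi; omega), map_zero, zero_mul]

lemma symmetric_expansion_zero {w w' : R} (hw : w * w' = 1) (b : ℕ) :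
    ∀ I, b + 1 < I → w ^ (b + 1) + w' ^ (b + 1)
      = ∑ i ∈ Finset.range I, algebraMap ℂ R (symCoeff b 0 i) * ((1 - w) ^ 2 * w') ^ i := by
  have hv : (1 - w) ^ 2 * w' = w + w' - 2 := by linear_combination (w - 2) * hw
  induction b using Nat.twoStepInduction with
  | zero =>
    intro I hI
    rw [symmetric_expansion_of_le (I := 2) (by omega) (by omega), hv]
    have : symCoeff 0 0 1 = 1 := by
      have h := recipFactorial_natCast 2
      norm_num at h
      simp [symCoeff, recipFactorial_zero, h]
    simp [Finset.sum_range_succ, symCoeff_zero_zero, this, map_ofNat]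
  | one =>
    intro I hI
    rw [symmetric_expansion_of_le (I := 3) (by omega) (by omega), hv]
    have h1 : symCoeff 1 0 1 = 4 := by
      have h := recipFactorial_natCast 2
      have h' := recipFactorial_natCast 1
      norm_num at h h'
      simp [symCoeff, h, h', Nat.factorial]
      norm_num
    have h2 : symCoeff 1 0 2 = 1 := by
      have h := recipFactorial_natCast 4
      norm_num at h
      simp [symCoeff, recipFactorial_zero, h, Nat.factorial]
      norm_num
    simp only [Finset.sum_range_succ, Finset.sum_range_zero, symCoeff_zero_zero, h1, h2, map_one,
      map_ofNat]
    linear_combination (-2 : R) * hw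
  | more b ih0 ih1 =>
    intro I hI
    obtain ⟨I, rfl⟩ : ∃ I', I = I' + 1 := ⟨I - 1, by omega⟩
    have h0 := ih0 (I + 1) (by omega)
    have h1 := ih1 (I + 1) (by omega)
    have h1' := ih1 I (by omega)
    rw [Finset.sum_range_succ', symCoeff_zero_zero] at *
    simp only [symCoeff_zero_recurrence, map_add, map_sub, map_mul, add_mul, sub_mul,
      Finset.sum_add_distrib, Finset.sum_sub_distrib]
    have e1 : ∑ i ∈ Finset.range I, algebraMap ℂ R (symCoeff (b + 1) 0 i)
        * ((1 - w) ^ 2 * w') ^ (i + 1)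
        = (w ^ (b + 1 + 1) + w' ^ (b + 1 + 1)) * ((1 - w) ^ 2 * w') := by
      rw [h1', Finset.sum_mul]
      exact Finset.sum_congr rfl fun i _ => by ring
    have e2 : ∑ i ∈ Finset.range I, algebraMap ℂ R 2 * algebraMap ℂ R (symCoeff (b + 1) 0 (i + 1))
        * ((1 - w) ^ 2 * w') ^ (i + 1)
        = 2 * (w ^ (b + 1 + 1) + w' ^ (b + 1 + 1) - algebraMap ℂ R 2) := by
      rw [h1, pow_zero, mul_one, add_sub_cancel_right, Finset.mul_sum, map_ofNat]
      exact Finset.sum_congr rfl fun i _ => by ring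
    have e3 : ∑ i ∈ Finset.range I, algebraMap ℂ R (symCoeff b 0 (i + 1))
        * ((1 - w) ^ 2 * w') ^ (i + 1) = w ^ (b + 1) + w' ^ (b + 1) - algebraMap ℂ R 2 := by
      rw [h0, pow_zero, mul_one, add_sub_cancel_right]
    rw [e1, e2, e3, hv, map_ofNat]
    linear_combination (-(w ^ (b + 1)) - w' ^ (b + 1)) * hw

lemma symmetric_expansion {w w' : R} (hw : w * w' = 1) (j : ℕ) :
    ∀ b I, b + 1 + j < I →
      (1 - w) ^ j * w ^ (b + 1) + (-1) ^ j * (1 - w) ^ j * w' ^ (b + 1 + j)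
      = ∑ i ∈ Finset.range I, algebraMap ℂ R (symCoeff b j i) * ((1 - w) ^ 2 * w') ^ i := by
  induction j with
  | zero =>
    intro b I hI
    rw [← symmetric_expansion_zero hw b I (by omega)]
    simp
  | succ j ih =>
    intro b I hI
    simp only [symCoeff_succ_col, map_sub, sub_mul, Finset.sum_sub_distrib]
    rw [← ih b I (by omega), ← ih (b + 1) I (by omega)]
    have : w' ^ (b + 1 + j) = w * w' ^ (b + 1 + (j + 1)) := by
      linear_combination (-w' ^ (b + 1 + j)) * hw
    rw [this, show b + 1 + 1 + j = b + 1 + (j + 1) by ring]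
    ring

end SymmetricExpansion


/-- Coefficients of the hypergeometric polynomial `∑ j, f j * u ^ j` for which the expansion of
`w ^ M * ∑ j, f j * (w * (1 - w)) ^ j`, symmetrized under `w ↦ 1 / w`, starts at order `N`. -/
noncomputable def hyperCoeff (M N : ℕ) : ℕ → ℂ
  | 0 => 0
  | 1 => 1
  | j + 2 => 2 * ((j : ℂ) + 1 - N) * (2 * j + 2 * M + 3) * (j + 1 + M + N)
      / ((j + 1) * (j + 2 - 2 * N) * (j + 2 + 2 * M + 2 * N)) * hyperCoeff M N (j + 1)

lemma hyperCoeff_eq_zero {M N : ℕ} (hN : 1 ≤ N) {j : ℕ} (hj : N < j) : hyperCoeff M N j = 0 := by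
  induction j, hj using Nat.le_induction with
  | base =>
    obtain ⟨n, rfl⟩ : ∃ n, N = n + 1 := ⟨N - 1, by omega⟩
    simp [hyperCoeff]
  | succ j hj ih =>
    obtain ⟨n, rfl⟩ : ∃ n, j = n + 1 := ⟨j - 1, by omega⟩
    rw [hyperCoeff, ih, mul_zero]

lemma hyperCoeff_recurrence {M N : ℕ} (hN : 1 ≤ N) (j : ℕ) :
    (j : ℂ) * (j + 1 - 2 * N) * (j + 1 + 2 * M + 2 * N) * hyperCoeff M N (j + 1)
      = 2 * ((j : ℂ) - N) * (2 * j + 2 * M + 1) * (j + M + N) * hyperCoeff M N j := by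
  rcases lt_trichotomy j N with h | h | h
  · cases j with
    | zero => simp [hyperCoeff]
    | succ j =>
      have h1 : ((j : ℂ) + 1) ≠ 0 := by exact_mod_cast j.succ_ne_zero
      have h2 : ((j : ℂ) + 2 - 2 * N) ≠ 0 := by
        rw [sub_ne_zero]
        exact_mod_cast (by omega : j + 2 ≠ 2 * N)
      have h3 : ((j : ℂ) + 2 + 2 * M + 2 * N) ≠ 0 := by
        exact_mod_cast (by omega : j + 2 + 2 * M + 2 * N ≠ 0)
      rw [hyperCoeff]
      push_cast
      field_simp
      ring
  · rw [hyperCoeff_eq_zero hN (by omega : N < j + 1), h]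
    ring
  · rw [hyperCoeff_eq_zero hN h, hyperCoeff_eq_zero hN (by omega : N < j + 1)]
    ring

lemma hyperCoeff_ne_zero {M N : ℕ} {j : ℕ} (hj : 1 ≤ j) (hjN : j ≤ N) :
    hyperCoeff M N j ≠ 0 := by
  induction j, hj using Nat.le_induction with
  | base => simp [hyperCoeff]
  | succ j hj ih =>
    obtain ⟨n, rfl⟩ : ∃ n, j = n + 1 := ⟨j - 1, by omega⟩
    rw [hyperCoeff]
    have h0 : ((n : ℂ) + 1 - N) ≠ 0 := by
      rw [sub_ne_zero]
      exact_mod_cast (by omega : n + 1 ≠ N)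
    have h1 : ((n : ℂ) + 1) ≠ 0 := by exact_mod_cast n.succ_ne_zero
    have h2 : ((n : ℂ) + 2 - 2 * N) ≠ 0 := by
      rw [sub_ne_zero]
      exact_mod_cast (by omega : n + 2 ≠ 2 * N)
    have h3 : ((n : ℂ) + 2 + 2 * M + 2 * N) ≠ 0 := by
      exact_mod_cast (by omega : n + 2 + 2 * M + 2 * N ≠ 0)
    have h4 : (2 * (n : ℂ) + 2 * M + 3) ≠ 0 := by
      exact_mod_cast (by omega : 2 * n + 2 * M + 3 ≠ 0)
    have h5 : ((n : ℂ) + 1 + M + N) ≠ 0 := by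
      exact_mod_cast (by omega : n + 1 + M + N ≠ 0)
    exact mul_ne_zero (div_ne_zero (mul_ne_zero (mul_ne_zero (mul_ne_zero two_ne_zero h0)
      h4) h5) (mul_ne_zero (mul_ne_zero h1 h2) h3)) (ih (by omega))

/-- Coefficient of `v ^ i` in the symmetrized hypergeometric polynomial of weight `m + 1`. -/
noncomputable def hyperSym (m N i : ℕ) : ℂ :=
  ∑ j ∈ Finset.range (N + 1), hyperCoeff (m + 1) N j * symCoeff (m + j) j i

/-- Telescoping certificate for `hyperSym_recurrence`. -/
noncomputable def symCert (m j i : ℕ) : ℂ :=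
  (-1) ^ j * (3 * i + m + 3) * ((m + i + j).factorial : ℕ) * recipFactorial (2 * i + 2 - j)
    * recipFactorial (m - i - 1 + 2 * j)

lemma symCoeff_telescope (m N j i : ℕ) :
    2 * (2 * (i : ℂ) + 1) * (i + 1 - N) * (i + m + 2 + N) * symCoeff (m + j) j (i + 1)
      + (i + m + 2) * (i + m + 1 + 2 * N) * (i - m - 1 - 2 * N) * symCoeff (m + j) j i
    = ((j : ℂ) - 1) * (j - 2 * N) * (j + 2 * (m + 1) + 2 * N) * symCert m j i
      - 2 * ((j : ℂ) - N) * (2 * j + 2 * (m + 1) + 1) * (j + (m + 1) + N)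
        * symCert m (j + 1) i := by
  unfold symCoeff symCert
  have e1 : m + j + (i + 1) = (m + i + j) + 1 := by ring
  have e2 : m + j + i = m + i + j := by ring
  have e3 : m + i + (j + 1) = (m + i + j) + 1 := by ring
  have c1 : 2 * ((i + 1 : ℕ) : ℤ) - (j : ℤ) = 2 * i + 2 - j := by push_cast; ring
  have c2 : ((m + j : ℕ) : ℤ) + 1 - ((i + 1 : ℕ) : ℤ) + j = m - i + 2 * j := by push_cast; ring
  have c3 : ((m + j : ℕ) : ℤ) + 1 - (i : ℤ) + j = m + 1 - i + 2 * j := by push_cast; ring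
  have c4 : 2 * (i : ℤ) + 2 - ((j + 1 : ℕ) : ℤ) = 2 * i + 1 - j := by push_cast; ring
  have c5 : (m : ℤ) - i - 1 + 2 * ((j + 1 : ℕ) : ℤ) = m + 1 - i + 2 * j := by push_cast; ring
  rw [e1, e2, e3, c1, c2, c3, c4, c5, Nat.factorial_succ,
    recipFactorial_of_add_one_eq (z := (m : ℤ) - i - 1 + 2 * j) (z' := m - i + 2 * j) (by ring),
    recipFactorial_of_add_one_eq (z := (m : ℤ) - i + 2 * j) (z' := m + 1 - i + 2 * j) (by ring),
    recipFactorial_of_add_one_eq (z := 2 * (i : ℤ) - j) (z' := 2 * i + 1 - j) (by ring),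
    recipFactorial_of_add_one_eq (z := 2 * (i : ℤ) + 1 - j) (z' := 2 * i + 2 - j) (by ring)]
  push_cast
  ring

lemma hyperSym_recurrence {N : ℕ} (hN : 1 ≤ N) (m i : ℕ) :
    2 * (2 * (i : ℂ) + 1) * (i + 1 - N) * (i + m + 2 + N) * hyperSym m N (i + 1)
      = (i + m + 2) * (i + m + 1 + 2 * N) * (m + 1 + 2 * N - i) * hyperSym m N i := by
  set F : ℕ → ℂ := fun j => hyperCoeff (m + 1) N j * (((j : ℂ) - 1) * (j - 2 * N)
    * (j + 2 * (m + 1) + 2 * N) * symCert m j i) with hF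
  have key : ∀ j, hyperCoeff (m + 1) N j *
      (2 * (2 * (i : ℂ) + 1) * (i + 1 - N) * (i + m + 2 + N) * symCoeff (m + j) j (i + 1)
      + (i + m + 2) * (i + m + 1 + 2 * N) * (i - m - 1 - 2 * N) * symCoeff (m + j) j i)
      = F j - F (j + 1) := by
    intro j
    have h := hyperCoeff_recurrence (M := m + 1) hN j
    rw [symCoeff_telescope]
    simp only [hF]
    push_cast at h ⊢
    linear_combination (symCert m (j + 1) i) * h
  have hsum := Finset.sum_range_sub' F (N + 1)
  rw [← Finset.sum_congr rfl fun j _ => key j] at hsum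
  have h0 : F 0 = 0 := by simp [hF, hyperCoeff]
  have h1 : F (N + 1) = 0 := by simp [hF, hyperCoeff_eq_zero hN]
  rw [h0, h1, sub_zero] at hsum
  rw [← sub_eq_zero, ← hsum]
  unfold hyperSym
  rw [Finset.mul_sum, Finset.mul_sum, ← Finset.sum_sub_distrib]
  exact Finset.sum_congr rfl fun j _ => by ring

lemma hyperSym_eq_zero {N : ℕ} (hN : 1 ≤ N) (m : ℕ) {i : ℕ} (hi : i < N) :
    hyperSym m N i = 0 := by
  induction i with
  | zero =>
    refine Finset.sum_eq_zero fun j _ => ?_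
    rcases Nat.eq_zero_or_pos j with rfl | hj
    · simp [hyperCoeff]
    · unfold symCoeff
      rw [recipFactorial_of_neg (z := 2 * ((0 : ℕ) : ℤ) - j) (by omega)]
      ring
  | succ i ih =>
    have h := hyperSym_recurrence hN m i
    rw [ih (by omega), mul_zero] at h
    have h1 : (2 * (i : ℂ) + 1) ≠ 0 := by exact_mod_cast (by omega : 2 * i + 1 ≠ 0)
    have h2 : ((i : ℂ) + 1 - N) ≠ 0 := by
      rw [sub_ne_zero]
      exact_mod_cast hi.ne
    have h3 : ((i : ℂ) + m + 2 + N) ≠ 0 := by exact_mod_cast (by omega : i + m + 2 + N ≠ 0)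
    simpa [h1, h2, h3] using h

lemma hyperSym_top {N : ℕ} (m : ℕ) :
    hyperSym m N (m + 1 + 2 * N) = (-1) ^ N * hyperCoeff (m + 1) N N := by
  unfold hyperSym
  rw [Finset.sum_eq_single_of_mem N (by simp)]
  · unfold symCoeff
    have c1 : 2 * ((m + 1 + 2 * N : ℕ) : ℤ) - N = ((2 * m + 2 + 3 * N : ℕ) : ℤ) := by
      push_cast; ring
    have c2 : ((m + N : ℕ) : ℤ) + 1 - ((m + 1 + 2 * N : ℕ) : ℤ) + N = 0 := by push_cast; ring
    have e1 : m + N + (m + 1 + 2 * N) = 2 * m + 1 + 3 * N := by ring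
    have e2 : 2 * m + 2 + 3 * N = (2 * m + 1 + 3 * N) + 1 := by ring
    rw [c1, c2, e1, e2, recipFactorial_natCast, recipFactorial_zero, Nat.factorial_succ]
    have h1 : (((2 * m + 1 + 3 * N).factorial : ℕ) : ℂ) ≠ 0 := by
      exact_mod_cast Nat.factorial_ne_zero _
    have h2 : (2 * (m : ℂ) + 1 + 3 * N + 1) ≠ 0 := by
      exact_mod_cast (by omega : 2 * m + 1 + 3 * N + 1 ≠ 0)
    push_cast
    rw [show 2 * ((m : ℂ) + N) + 2 + N = 2 * (m : ℂ) + 1 + 3 * N + 1 by ring]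
    field_simp
  · intro j hj hjN
    unfold symCoeff
    rw [recipFactorial_of_neg (z := ((m + j : ℕ) : ℤ) + 1 - ((m + 1 + 2 * N : ℕ) : ℤ) + j)
      (by simp at hj; push_cast; omega)]
    ring

lemma hyperSym_closed_form {N : ℕ} (hN : 1 ≤ N) (m d s : ℕ) (hds : d + s = m + 1 + N) :
    hyperSym m N (N + d) * (s.factorial * (2 * (N + d)).factorial * d.factorial
        * (m + 1 + 2 * N + d).factorial : ℕ) * ((m + 3 * N).factorial * N.factorial : ℕ)
      = hyperSym m N N * ((2 * N).factorial * (m + 1 + 2 * N).factorial : ℕ)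
        * ((m + 1 + N + d).factorial * (m + 3 * N + d).factorial * (N + d).factorial : ℕ) := by
  induction d generalizing s with
  | zero =>
    obtain rfl : s = m + 1 + N := by omega
    simp only [Nat.add_zero, Nat.factorial_zero]
    push_cast
    ring
  | succ d ih =>
    have h := ih (s + 1) (by omega)
    have hr := hyperSym_recurrence hN m (N + d)
    have hs : (s : ℂ) = m + N - d := by
      have : ((d + 1 + s : ℕ) : ℂ) = ((m + 1 + N : ℕ) : ℂ) := by rw [hds]
      push_cast at this
      linear_combination this
    have e1 : 2 * (N + (d + 1)) = 2 * (N + d) + 1 + 1 := by ring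
    have e2 : m + 1 + 2 * N + (d + 1) = m + 1 + 2 * N + d + 1 := by ring
    have e3 : m + 1 + N + (d + 1) = m + 1 + N + d + 1 := by ring
    have e4 : m + 3 * N + (d + 1) = m + 3 * N + d + 1 := by ring
    rw [e1, e2, e3, e4, ← Nat.add_assoc N d 1, Nat.factorial_succ (2 * (N + d) + 1),
      Nat.factorial_succ (2 * (N + d)), Nat.factorial_succ d,
      Nat.factorial_succ (m + 1 + 2 * N + d), Nat.factorial_succ (m + 1 + N + d),
      Nat.factorial_succ (m + 3 * N + d), Nat.factorial_succ (N + d)]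
    rw [Nat.factorial_succ s] at h
    push_cast at h hr ⊢
    rw [hs] at h
    linear_combination ((N : ℂ) + d + 1) * ((s.factorial : ℂ) * (2 * (N + d)).factorial
      * d.factorial * (m + 1 + 2 * N + d).factorial * (m + 3 * N).factorial * N.factorial) * hr
      + ((N : ℂ) + d + 1) * (m + N + d + 2) * (m + 3 * N + d + 1) * h

lemma hyperSym_order {N : ℕ} (hN : 1 ≤ N) (m : ℕ) :
    hyperSym m N N * ((2 * N).factorial * (m + 1 + 2 * N).factorial * (m + 2 * N).factorial
        * (2 * m + 2 + 2 * N).factorial : ℕ)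
      = 2 * (-1) ^ N * hyperCoeff (m + 1) N N * ((m + 3 * N).factorial * N.factorial
        * (m + 1 + N).factorial * (2 * m + 2 + 3 * N).factorial : ℕ) := by
  have h := hyperSym_closed_form hN m (m + 1 + N) 0 (by ring)
  have htop := hyperSym_top (N := N) m
  have e0 : N + (m + 1 + N) = m + 1 + 2 * N := by ring
  have e1 : 2 * (m + 1 + 2 * N) = (2 * m + 1 + 4 * N) + 1 := by ring
  have e2 : m + 1 + 2 * N + (m + 1 + N) = 2 * m + 2 + 3 * N := by ring
  have e3 : m + 1 + N + (m + 1 + N) = 2 * m + 2 + 2 * N := by ring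
  have e4 : m + 3 * N + (m + 1 + N) = 2 * m + 1 + 4 * N := by ring
  have e5 : m + 1 + 2 * N = (m + 2 * N) + 1 := by ring
  rw [e0, htop, e1, e2, e3, e4, Nat.factorial_succ (2 * m + 1 + 4 * N), Nat.factorial_zero] at h
  rw [e5, Nat.factorial_succ (m + 2 * N)] at h ⊢
  have n1 : (((2 * m + 1 + 4 * N).factorial : ℕ) : ℂ) ≠ 0 := by
    exact_mod_cast Nat.factorial_ne_zero _
  have n2 : ((m : ℂ) + 2 * N + 1) ≠ 0 := by exact_mod_cast (by omega : m + 2 * N + 1 ≠ 0)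
  push_cast at h ⊢
  apply mul_right_cancel₀ (mul_ne_zero n1 n2)
  linear_combination (-1 : ℂ) * h

/-- Binomial coefficients with an integer lower index, zero out of range. -/
noncomputable def intChoose (n : ℕ) (z : ℤ) : ℂ :=
  (n.factorial : ℕ) * recipFactorial z * recipFactorial (n - z)

lemma intChoose_natCast {n k : ℕ} (h : k ≤ n) : intChoose n k = (n.choose k : ℂ) := by
  unfold intChoose
  rw [← Nat.cast_sub h, recipFactorial_natCast, recipFactorial_natCast, Nat.cast_choose ℂ h]
  field_simp

lemma intChoose_of_neg {n : ℕ} {z : ℤ} (hz : z < 0) : intChoose n z = 0 := by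
  rw [intChoose, recipFactorial_of_neg hz, mul_zero, zero_mul]

lemma intChoose_succ (n : ℕ) (z : ℤ) :
    intChoose (n + 1) z = intChoose n z + intChoose n (z - 1) := by
  unfold intChoose
  rw [Nat.factorial_succ, recipFactorial_of_add_one_eq (z := z - 1) (z' := z) (by ring),
    recipFactorial_of_add_one_eq (z := (n : ℤ) - z) (z' := (n : ℤ) + 1 - z) (by ring),
    show (n : ℤ) - (z - 1) = (n : ℤ) + 1 - z by ring]
  push_cast
  ring

section PowerSeries

open PowerSeries

lemma mk_one_mul_one_sub : (1 - X : ℂ⟦X⟧) * mk 1 = 1 := by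
  rw [mul_comm]
  exact mk_one_mul_one_sub_eq_one ℂ

lemma coeff_X_pow_mul_mk_one_pow (p l i : ℕ) :
    coeff i ((X : ℂ⟦X⟧) ^ l * mk 1 ^ (p + 1 + l)) = intChoose (p + i) (i - l) := by
  rw [coeff_X_pow_mul']
  split_ifs with h
  · rw [show p + 1 + l = p + l + 1 by ring, mk_one_pow_eq_mk_choose_add, coeff_mk,
      ← Nat.cast_sub h, intChoose_natCast (by omega), show p + l + (i - l) = p + i by omega,
      ← Nat.choose_symm (by omega : i - l ≤ p + i), show p + i - (i - l) = p + l by omega]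
  · rw [intChoose_of_neg (by omega)]

/-- The polynomial `∑ j, f j * (X * (1 - X)) ^ j`. -/
noncomputable def symPoly (f : ℕ → ℂ) (N : ℕ) : Polynomial ℂ :=
  ∑ j ∈ Finset.range (N + 1), Polynomial.C (f j) * (Polynomial.X * (1 - Polynomial.X)) ^ j

lemma symPoly_hyperCoeff_expansion (m N I : ℕ) (hI : m + 1 + 2 * N < I) :
    (symPoly (hyperCoeff (m + 1) N) N : ℂ⟦X⟧)
      + mk 1 ^ (2 * m + 2) * Polynomial.aeval (-(X * mk 1 : ℂ⟦X⟧))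
          (symPoly (hyperCoeff (m + 1) N) N)
      = ∑ i ∈ Finset.range I, algebraMap ℂ ℂ⟦X⟧ (hyperSym m N i)
          * (X ^ (2 * i) * mk 1 ^ (m + i + 1)) := by
  have hw := mk_one_mul_one_sub
  set w' : ℂ⟦X⟧ := mk 1 with hw'
  have h1 : 1 - -(X * w') = w' := by linear_combination (-1 : ℂ⟦X⟧) * hw
  have hT : ((symPoly (hyperCoeff (m + 1) N) N : Polynomial ℂ) : ℂ⟦X⟧)
      = ∑ j ∈ Finset.range (N + 1), algebraMap ℂ ℂ⟦X⟧ (hyperCoeff (m + 1) N j)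
          * (X * (1 - X)) ^ j := by
    rw [← Polynomial.coeToPowerSeries.ringHom_apply, symPoly, map_sum]
    refine Finset.sum_congr rfl fun j _ => ?_
    simp
  have hpow : ∀ k, (1 - X : ℂ⟦X⟧) ^ k * w' ^ k = 1 := fun k => by
    rw [← mul_pow, hw, one_pow]
  rw [hT, symPoly, map_sum, Finset.mul_sum, ← Finset.sum_add_distrib]
  have hterm : ∀ j ∈ Finset.range (N + 1),
      algebraMap ℂ ℂ⟦X⟧ (hyperCoeff (m + 1) N j) * (X * (1 - X)) ^ j
        + w' ^ (2 * m + 2) * Polynomial.aeval (-(X * w'))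
          (Polynomial.C (hyperCoeff (m + 1) N j) * (Polynomial.X * (1 - Polynomial.X)) ^ j)
      = ∑ i ∈ Finset.range I, algebraMap ℂ ℂ⟦X⟧ (hyperCoeff (m + 1) N j * symCoeff (m + j) j i)
          * (X ^ (2 * i) * w' ^ (m + i + 1)) := by
    intro j hj
    have hexp := symmetric_expansion hw j (m + j) I (by simp at hj; omega)
    rw [show (1 : ℂ⟦X⟧) - (1 - X) = X by ring] at hexp
    have hs : ∑ i ∈ Finset.range I,
          algebraMap ℂ ℂ⟦X⟧ (hyperCoeff (m + 1) N j * symCoeff (m + j) j i)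
          * (X ^ (2 * i) * w' ^ (m + i + 1))
        = algebraMap ℂ ℂ⟦X⟧ (hyperCoeff (m + 1) N j) * w' ^ (m + 1)
          * ∑ i ∈ Finset.range I, algebraMap ℂ ℂ⟦X⟧ (symCoeff (m + j) j i) * (X ^ 2 * w') ^ i := by
      rw [Finset.mul_sum]
      refine Finset.sum_congr rfl fun i _ => ?_
      rw [map_mul]
      ring
    rw [hs, ← hexp, map_mul, Polynomial.aeval_C, map_pow, map_mul, map_sub, map_one,
      Polynomial.aeval_X, h1]
    have e : w' ^ (m + 1) * (1 - X) ^ (m + j + 1) = (1 - X) ^ j := by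
      linear_combination (1 - X) ^ j * hpow (m + 1)
    rw [neg_mul, neg_pow, mul_pow, mul_pow, mul_pow, mul_add]
    rw [show w' ^ (m + j + 1 + j) = w' ^ (m + 1) * (w' ^ j * w' ^ j) by ring]
    linear_combination (-(algebraMap ℂ ℂ⟦X⟧ (hyperCoeff (m + 1) N j)) * X ^ j) * e
  rw [Finset.sum_congr rfl hterm, Finset.sum_comm]
  refine Finset.sum_congr rfl fun i _ => ?_
  rw [hyperSym, map_sum, Finset.sum_mul]

lemma natDegree_symPoly_lt (f : ℕ → ℂ) {N L : ℕ} (hL : 2 * N < L) :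
    (symPoly f N).natDegree < L := by
  refine lt_of_le_of_lt ?_ hL
  refine Polynomial.natDegree_sum_le_of_forall_le _ _ fun j hj => ?_
  refine (Polynomial.natDegree_C_mul_le _ _).trans (Polynomial.natDegree_pow_le.trans ?_)
  have h1 : (Polynomial.X * (1 - Polynomial.X) : Polynomial ℂ).natDegree ≤ 2 := by
    compute_degree
  have h2 : j ≤ N := by simpa [Nat.lt_succ_iff] using hj
  calc _ ≤ j * 2 := Nat.mul_le_mul_left _ h1
    _ ≤ _ := by omega

lemma symPoly_hyperCoeff_covariance {N : ℕ} (hN : 1 ≤ N) (m i L : ℕ) (hi : i ≤ 2 * N)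
    (hL : 2 * N < L) :
    (symPoly (hyperCoeff (m + 1) N) N).coeff i
      + ∑ l ∈ Finset.range L, (-1) ^ l * (symPoly (hyperCoeff (m + 1) N) N).coeff l
          * intChoose (2 * m + 1 + i) (i - l)
      = if i = 2 * N then hyperSym m N N else 0 := by
  have h := congrArg (coeff i) (symPoly_hyperCoeff_expansion m N (m + 2 + 2 * N) (by omega))
  rw [map_add, Polynomial.coeff_coe, Polynomial.aeval_eq_sum_range' (natDegree_symPoly_lt _ hL),
    Finset.mul_sum, map_sum, map_sum] at h
  have h1 : ∀ l ∈ Finset.range L, coeff i ((mk 1 : ℂ⟦X⟧) ^ (2 * m + 2)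
        * (symPoly (hyperCoeff (m + 1) N) N).coeff l • (-(X * mk 1 : ℂ⟦X⟧)) ^ l)
      = (-1) ^ l * (symPoly (hyperCoeff (m + 1) N) N).coeff l
          * intChoose (2 * m + 1 + i) (i - l) := by
    intro l _
    rw [← coeff_X_pow_mul_mk_one_pow, neg_pow, mul_pow, mul_smul_comm, coeff_smul,
      show (mk 1 : ℂ⟦X⟧) ^ (2 * m + 2) * ((-1) ^ l * (X ^ l * mk 1 ^ l))
        = C ((-1 : ℂ) ^ l) * (X ^ l * mk 1 ^ (2 * m + 1 + 1 + l)) by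
          rw [map_pow, map_neg, map_one]; ring, coeff_C_mul, smul_eq_mul]
    ring
  rw [Finset.sum_congr rfl h1] at h
  rw [h, Finset.sum_eq_single_of_mem N (by simp; omega)]
  · rw [PowerSeries.algebraMap_apply, coeff_C_mul, coeff_X_pow_mul']
    have h0 : coeff 0 ((mk 1 : ℂ⟦X⟧) ^ (m + N + 1)) = 1 := by
      simp [coeff_zero_eq_constantCoeff]
    split_ifs with ha hb hb
    · rw [hb, Nat.sub_self, h0]; simp
    · omega
    · omega
    · simp
  · intro b _ hb
    rcases lt_or_gt_of_ne hb with hb | hb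
    · rw [hyperSym_eq_zero hN m hb]
      simp
    · rw [PowerSeries.algebraMap_apply, coeff_C_mul, coeff_X_pow_mul', if_neg (by omega), mul_zero]

end PowerSeries

lemma exists_hypergeometric_solution (f : ℕ → ℂ) {N q : ℕ} (hq : 1 ≤ q)
    (hf : ∀ j, N < j → f j = 0) :
    ∃ S : ℕ → ℂ, (∀ j, N < j → S j = 0) ∧ ∀ j, f j
      = ((j : ℂ) + 1) * (j + q + 1) * S (j + 1) - (2 * j + q) * (2 * j + q + 1) * S j := by
  let a : ℕ → ℂ := fun d => Nat.rec 0 (fun d x =>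
    ((((N - d : ℕ) : ℂ) + 1) * ((N - d : ℕ) + q + 1) * x - f (N - d))
      / ((2 * (N - d : ℕ) + q) * (2 * (N - d : ℕ) + q + 1))) d
  have ha : ∀ d, a (d + 1) = ((((N - d : ℕ) : ℂ) + 1) * ((N - d : ℕ) + q + 1) * a d - f (N - d))
      / ((2 * (N - d : ℕ) + q) * (2 * (N - d : ℕ) + q + 1)) := fun d => rfl
  have ha0 : a 0 = 0 := rfl
  refine ⟨fun j => a (N + 1 - j), fun j hj => ?_, fun j => ?_⟩
  · simp only [show N + 1 - j = 0 by omega, ha0]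
  · rcases lt_or_ge N j with h | h
    · simp only [hf j h, show N + 1 - j = 0 by omega, show N + 1 - (j + 1) = 0 by omega, ha0]
      ring
    · have h1 : (2 * (j : ℂ) + q) ≠ 0 := by exact_mod_cast (by omega : 2 * j + q ≠ 0)
      have h2 : (2 * (j : ℂ) + q + 1) ≠ 0 := by exact_mod_cast (by omega : 2 * j + q + 1 ≠ 0)
      simp only [show N + 1 - j = (N - j) + 1 by omega, show N + 1 - (j + 1) = N - j by omega, ha,
        show N - (N - j) = j by omega]
      rw [mul_div_cancel₀ _ (mul_ne_zero h1 h2)]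
      ring

section Polynomial

open Polynomial

lemma hypergeometric_operator_pow (q j : ℕ) :
    X * (1 - X) * derivative (derivative ((X * (1 - X) : ℂ[X]) ^ j))
      + C ((q : ℂ) + 1) * (1 - 2 * X) * derivative ((X * (1 - X) : ℂ[X]) ^ j)
      - C ((q : ℂ) * (q + 1)) * (X * (1 - X)) ^ j
    = C ((j : ℂ) * (j + q)) * (X * (1 - X)) ^ (j - 1)
      - C ((2 * (j : ℂ) + q) * (2 * j + q + 1)) * (X * (1 - X)) ^ j := by
  rcases j with _ | _ | j
  · simp
  · simp [map_ofNat C 2]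
    ring
  · simp [derivative_pow, map_ofNat C 2]
    ring

lemma hypergeometric_operator_symPoly {f S : ℕ → ℂ} {N q : ℕ} (hS : ∀ j, N < j → S j = 0)
    (hf : ∀ j, f j
      = ((j : ℂ) + 1) * (j + q + 1) * S (j + 1) - (2 * j + q) * (2 * j + q + 1) * S j) :
    X * (1 - X) * derivative (derivative (symPoly S N))
      + C ((q : ℂ) + 1) * (1 - 2 * X) * derivative (symPoly S N)
      - C ((q : ℂ) * (q + 1)) * symPoly S N = symPoly f N := by
  have h1 : X * (1 - X) * derivative (derivative (symPoly S N))
      + C ((q : ℂ) + 1) * (1 - 2 * X) * derivative (symPoly S N)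
      - C ((q : ℂ) * (q + 1)) * symPoly S N
      = ∑ j ∈ Finset.range (N + 1), C (S j) * (C ((j : ℂ) * (j + q)) * (X * (1 - X)) ^ (j - 1)
      - C ((2 * (j : ℂ) + q) * (2 * j + q + 1)) * (X * (1 - X)) ^ j) := by
    simp only [← hypergeometric_operator_pow, symPoly, derivative_sum, derivative_C_mul,
      Finset.mul_sum]
    rw [← Finset.sum_add_distrib, ← Finset.sum_sub_distrib]
    exact Finset.sum_congr rfl fun j _ => by ring
  have h2 : ∑ j ∈ Finset.range (N + 1), C (S j) * (C ((j : ℂ) * (j + q)) * (X * (1 - X)) ^ (j - 1))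
      = ∑ j ∈ Finset.range (N + 1), C (S (j + 1)) * (C (((j : ℂ) + 1) * (j + 1 + q))
        * (X * (1 - X)) ^ j) := by
    rw [Finset.sum_range_succ', Finset.sum_range_succ]
    simp [hS]
  rw [h1, Finset.sum_congr rfl fun j _ => mul_sub (C (S j)) _ _, Finset.sum_sub_distrib, h2,
    ← Finset.sum_sub_distrib, symPoly]
  refine Finset.sum_congr rfl fun j _ => ?_
  rw [hf, C_sub]
  simp only [C_mul, C_add]
  ring

lemma coeff_hypergeometric_operator (Y : ℂ[X]) (q i : ℕ) :
    (X * (1 - X) * derivative (derivative Y) + C ((q : ℂ) + 1) * (1 - 2 * X) * derivative Y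
      - C ((q : ℂ) * (q + 1)) * Y).coeff i
    = (i + 1) * (i + q + 1) * Y.coeff (i + 1) - (i + q) * (i + q + 1) * Y.coeff i := by
  have h : X * (1 - X) * derivative (derivative Y) + C ((q : ℂ) + 1) * (1 - 2 * X) * derivative Y
      - C ((q : ℂ) * (q + 1)) * Y
      = X * derivative (derivative Y) - X * (X * derivative (derivative Y))
        + C ((q : ℂ) + 1) * derivative Y - C (2 * ((q : ℂ) + 1)) * (X * derivative Y)
        - C ((q : ℂ) * (q + 1)) * Y := by
    rw [C_mul (a := 2), map_ofNat C 2]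
    ring
  rw [h]
  rcases i with _ | _ | i <;>
    simp only [coeff_add, coeff_sub, coeff_C_mul, coeff_X_mul, coeff_X_mul_zero,
      coeff_derivative] <;>
    push_cast <;> ring

/-- The antiderivative of a polynomial with vanishing constant coefficient. -/
noncomputable def antideriv (Y : ℂ[X]) : ℂ[X] :=
  ∑ i ∈ Finset.range (Y.natDegree + 1), monomial (i + 1) (Y.coeff i / (i + 1))

lemma coeff_antideriv_zero (Y : ℂ[X]) : (antideriv Y).coeff 0 = 0 := by
  simp [antideriv, coeff_monomial]

lemma coeff_antideriv_succ (Y : ℂ[X]) (i : ℕ) :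
    (antideriv Y).coeff (i + 1) = Y.coeff i / (i + 1) := by
  simp only [antideriv, finsetSum_coeff, coeff_monomial, Nat.add_right_cancel_iff,
    Finset.sum_ite_eq', Finset.mem_range]
  split_ifs with h
  · rfl
  · rw [coeff_eq_zero_of_natDegree_lt (by omega), zero_div]

lemma derivative_antideriv (Y : ℂ[X]) : derivative (antideriv Y) = Y := by
  ext i
  have h : ((i : ℂ) + 1) ≠ 0 := by exact_mod_cast i.succ_ne_zero
  rw [coeff_derivative, coeff_antideriv_succ]
  field_simp

end Polynomial

/-- The transform `j ↦ ∑ l, (-1) ^ l * e l * C(r + j, j - l)`, under which the functional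
`X ^ i ↦ C(r + i + j, j)` acts on `∑ l, e l * (1 - X) ^ l`. -/
noncomputable def binomTransform (r L : ℕ) (e : ℕ → ℂ) (j : ℕ) : ℂ :=
  ∑ l ∈ Finset.range L, (-1) ^ l * e l * intChoose (r + j) (j - l)

lemma binomTransform_contiguous (r L : ℕ) (e : ℕ → ℂ) (i : ℕ) :
    ((i : ℂ) + 2) * binomTransform r L e (i + 2)
      - (i + r + 2) * binomTransform r L e (i + 1)
    = ∑ l ∈ Finset.range L, (-1) ^ l * (l * e l) * intChoose (r + 2 + i) (i + 2 - l) := by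
  unfold binomTransform
  rw [Finset.mul_sum, Finset.mul_sum, ← Finset.sum_sub_distrib]
  refine Finset.sum_congr rfl fun l _ => ?_
  unfold intChoose
  rw [show r + (i + 2) = (r + (i + 1)) + 1 by ring, show r + 2 + i = (r + (i + 1)) + 1 by ring,
    Nat.factorial_succ,
    recipFactorial_of_add_one_eq (z := ((i + 1 : ℕ) : ℤ) - l) (z' := i + 2 - l)
      (by push_cast; ring)]
  have e1 : ((i + 2 : ℕ) : ℤ) - l = i + 2 - l := by push_cast; ring
  have e2 : ((r + (i + 1) : ℕ) : ℤ) - (((i + 1 : ℕ) : ℤ) - l) = r + l := by push_cast; ring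
  have e3 : ((r + (i + 1) + 1 : ℕ) : ℤ) - ((i : ℤ) + 2 - l) = r + l := by push_cast; ring
  rw [e1, e2, e3]
  push_cast
  ring

lemma intChoose_covariance (q i p : ℕ) :
    ((q : ℂ) + i + 1) * (i + 1) * intChoose (q + i) (i + 2 - p)
      = (p - 1 + q) * ((p - 1) * intChoose (q + 1 + i) (i + 2 - p)
        + (p + q) * intChoose (q + 1 + i) (i + 1 - p)) := by
  unfold intChoose
  have e1 : ((q + i : ℕ) : ℤ) - ((i : ℤ) + 2 - p) = q + p - 2 := by push_cast; ring
  have e2 : ((q + 1 + i : ℕ) : ℤ) - ((i : ℤ) + 2 - p) = q + p - 1 := by push_cast; ring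
  have e3 : ((q + 1 + i : ℕ) : ℤ) - ((i : ℤ) + 1 - p) = q + p := by push_cast; ring
  rw [e1, e2, e3, show q + 1 + i = q + i + 1 by ring, Nat.factorial_succ,
    recipFactorial_of_add_one_eq (z := (q : ℤ) + p - 2) (z' := q + p - 1) (by ring),
    recipFactorial_of_add_one_eq (z := (q : ℤ) + p - 1) (z' := q + p) (by ring),
    recipFactorial_of_add_one_eq (z := (i : ℤ) + 1 - p) (z' := i + 2 - p) (by ring)]
  push_cast
  ring

lemma binomTransform_covariance {r L : ℕ} {e τ : ℕ → ℂ}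
    (he : ∀ l, L ≤ l → e l = 0)
    (hτ : ∀ i : ℕ, τ i
      = (i + r + 3) * (i + 1) * ((i + 2) * e (i + 2) - (i + r + 2) * e (i + 1))) (i : ℕ) :
    ((i : ℂ) + r + 3) * (i + 1) * ((i + 2) * binomTransform r L e (i + 2)
      - (i + r + 2) * binomTransform r L e (i + 1))
    = ∑ l ∈ Finset.range L, (-1) ^ l * τ l * intChoose (r + 2 + 1 + i) (i - l) := by
  rw [binomTransform_contiguous]
  set F : ℕ → ℂ := fun p => (-1) ^ p * ((p + r + 1) * (p - 1) * p) * e p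
    * intChoose (r + 2 + 1 + i) (i + 2 - p) with hF
  set G : ℕ → ℂ := fun p => (-1) ^ p * ((p + r + 2) * p * (p + r + 1)) * e p
    * intChoose (r + 2 + 1 + i) (i + 1 - p) with hG
  have h1 : ∑ l ∈ Finset.range L, (-1) ^ l * τ l * intChoose (r + 2 + 1 + i) (i - l)
      = ∑ l ∈ Finset.range L, F (l + 2) + ∑ l ∈ Finset.range L, G (l + 1) := by
    rw [← Finset.sum_add_distrib]
    refine Finset.sum_congr rfl fun l _ => ?_
    simp only [hF, hG, hτ]
    have e1 : (i : ℤ) + 2 - ((l + 2 : ℕ) : ℤ) = i - l := by push_cast; ring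
    have e2 : (i : ℤ) + 1 - ((l + 1 : ℕ) : ℤ) = i - l := by push_cast; ring
    rw [e1, e2]
    push_cast
    ring
  have h2 : ∑ l ∈ Finset.range L, F (l + 2) = ∑ l ∈ Finset.range (L + 2), F l := by
    rw [Finset.sum_range_succ', Finset.sum_range_succ']
    simp only [hF, Nat.cast_zero, Nat.cast_one, mul_zero, zero_mul, add_zero, sub_self,
      zero_add]
  have h3 : ∑ l ∈ Finset.range L, G (l + 1) = ∑ l ∈ Finset.range (L + 2), G l := by
    rw [Finset.sum_range_succ, Finset.sum_range_succ']
    simp [hG, he]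
  have h4 : ∑ l ∈ Finset.range L, (-1) ^ l * (l * e l) * intChoose (r + 2 + i) (i + 2 - l)
      = ∑ l ∈ Finset.range (L + 2), (-1) ^ l * (l * e l) * intChoose (r + 2 + i) (i + 2 - l) := by
    rw [Finset.sum_range_succ, Finset.sum_range_succ, he L le_rfl, he (L + 1) (by omega)]
    ring
  rw [h1, h2, h3, h4, ← Finset.sum_add_distrib, Finset.mul_sum]
  refine Finset.sum_congr rfl fun p _ => ?_
  have h := intChoose_covariance (r + 2) i p
  simp only [hF, hG]
  push_cast at h ⊢
  linear_combination ((-1) ^ p * p * e p) * h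

lemma binomTransform_one {r L : ℕ} (hL : 2 ≤ L) {e : ℕ → ℂ} (he0 : e 0 = 0) :
    binomTransform r L e 1 = -e 1 := by
  unfold binomTransform
  rw [Finset.sum_eq_single_of_mem 1 (by simp; omega)]
  · have : intChoose (r + 1) (((1 : ℕ) : ℤ) - ((1 : ℕ) : ℤ)) = 1 := by
      rw [sub_self]
      simpa using intChoose_natCast (Nat.zero_le (r + 1))
    rw [this]
    ring
  · intro l _ hl
    rcases Nat.eq_zero_or_pos l with rfl | h
    · simp [he0]
    · rw [intChoose_of_neg (by omega), mul_zero]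

lemma add_binomTransform {r L K : ℕ} (hL : 2 ≤ L) {e τ : ℕ → ℂ} {g : ℂ} (he0 : e 0 = 0)
    (he : ∀ l, L ≤ l → e l = 0)
    (hτ : ∀ i : ℕ, τ i
      = (i + r + 3) * (i + 1) * ((i + 2) * e (i + 2) - (i + r + 2) * e (i + 1)))
    (hg : ∀ i, i ≤ K → τ i
      + ∑ l ∈ Finset.range L, (-1) ^ l * τ l * intChoose (r + 2 + 1 + i) (i - l)
      = if i = K then g else 0) :
    (∀ j, j ≤ K → e (j + 1) + binomTransform r L e (j + 1) = 0) ∧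
      (K + r + 3) * (K + 1) * (K + 2) * (e (K + 2) + binomTransform r L e (K + 2)) = g := by
  have key : ∀ i : ℕ, i ≤ K → ((i : ℂ) + r + 3) * (i + 1)
      * ((i + 2) * (e (i + 2) + binomTransform r L e (i + 2))
      - (i + r + 2) * (e (i + 1) + binomTransform r L e (i + 1))) = if i = K then g else 0 := by
    intro i hi
    rw [← hg i hi, ← binomTransform_covariance he hτ, hτ]
    ring
  have hz : ∀ j, j ≤ K → e (j + 1) + binomTransform r L e (j + 1) = 0 := by
    intro j
    induction j with
    | zero => intro _; rw [binomTransform_one hL he0]; ring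
    | succ j ih =>
      intro hj
      have h := key j (by omega)
      rw [ih (by omega), if_neg (by omega), mul_zero, sub_zero] at h
      have h1 : ((j : ℂ) + r + 3) ≠ 0 := by exact_mod_cast (by omega : j + r + 3 ≠ 0)
      have h2 : ((j : ℂ) + 1) ≠ 0 := by exact_mod_cast j.succ_ne_zero
      have h3 : ((j : ℂ) + 2) ≠ 0 := by exact_mod_cast (by omega : j + 2 ≠ 0)
      simpa [h1, h2, h3] using h
  refine ⟨hz, ?_⟩
  have h := key K le_rfl
  rw [hz K le_rfl, if_pos rfl] at h
  rw [← h]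
  ring

section Functional

open Polynomial

/-- The functional `X ^ i ↦ C(r + i + j, j)` on polynomials. -/
noncomputable def chooseFunctional (r j : ℕ) : ℂ[X] →ₗ[ℂ] ℂ :=
  Polynomial.lsum fun i => ((r + i + j).choose j : ℂ) • LinearMap.id

lemma chooseFunctional_monomial (r j i : ℕ) (a : ℂ) :
    chooseFunctional r j (monomial i a) = ((r + i + j).choose j : ℂ) * a := by
  simp [chooseFunctional, Polynomial.lsum_apply, sum_monomial_index]

lemma chooseFunctional_eq_sum_range (r j : ℕ) {P : ℂ[X]} {L : ℕ} (hP : P.natDegree < L) :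
    chooseFunctional r j P
      = ∑ i ∈ Finset.range L, P.coeff i * ((r + i + j).choose j : ℂ) := by
  conv_lhs => rw [P.as_sum_range' L hP]
  rw [map_sum]
  exact Finset.sum_congr rfl fun i _ => by rw [chooseFunctional_monomial, mul_comm]

lemma chooseFunctional_X_mul (r j : ℕ) (P : ℂ[X]) :
    chooseFunctional r j (X * P) = chooseFunctional (r + 1) j P := by
  induction P using Polynomial.induction_on' with
  | add p q hp hq => rw [mul_add, map_add, map_add, hp, hq]
  | monomial i a =>
    rw [X_mul_monomial, chooseFunctional_monomial, chooseFunctional_monomial,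
      show r + (i + 1) + j = r + 1 + i + j by ring]

lemma chooseFunctional_one_sub_X_pow (r j l : ℕ) :
    chooseFunctional r j ((1 - X) ^ l) = (-1) ^ l * intChoose (r + j) (j - l) := by
  induction l generalizing r with
  | zero =>
    rw [pow_zero, ← monomial_zero_one, chooseFunctional_monomial, Nat.cast_zero, sub_zero,
      intChoose_natCast (by omega)]
    simp
  | succ l ih =>
    rw [pow_succ', sub_mul, one_mul, map_sub, chooseFunctional_X_mul, ih, ih,
      show r + 1 + j = r + j + 1 by ring, intChoose_succ,
      show (j : ℤ) - ((l + 1 : ℕ) : ℤ) = j - l - 1 by push_cast; ring]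
    ring

lemma chooseFunctional_comp_one_sub_X (r j : ℕ) {E : ℂ[X]} {L : ℕ} (hE : E.natDegree < L) :
    chooseFunctional r j (E.comp (1 - X)) = binomTransform r L E.coeff j := by
  rw [comp_eq_sum_left, sum_over_range' _ (by simp) L hE, map_sum, binomTransform]
  refine Finset.sum_congr rfl fun l _ => ?_
  rw [← smul_eq_C_mul, map_smul, chooseFunctional_one_sub_X_pow, smul_eq_mul]
  ring

lemma symPoly_comp_one_sub_X (f : ℕ → ℂ) (N : ℕ) : (symPoly f N).comp (1 - X) = symPoly f N := by
  simp only [symPoly, Polynomial.sum_comp, mul_comp, C_comp, pow_comp, sub_comp, one_comp, X_comp]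
  exact Finset.sum_congr rfl fun j _ => by ring

lemma coeff_symPoly_top (f : ℕ → ℂ) (N : ℕ) : (symPoly f N).coeff (2 * N) = (-1) ^ N * f N := by
  have h1 : (X * (1 - X) : ℂ[X]).natDegree ≤ 2 := by compute_degree
  have h2 : (X * (1 - X) : ℂ[X]).coeff 2 = -1 := by
    rw [coeff_X_mul]
    simp [coeff_one, coeff_X]
  rw [symPoly, finsetSum_coeff, Finset.sum_range_succ, Finset.sum_eq_zero, zero_add, coeff_C_mul,
    mul_comm 2 N, coeff_pow_of_natDegree_le h1, h2, mul_comm]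
  intro j hj
  rw [coeff_C_mul, coeff_eq_zero_of_natDegree_lt, mul_zero]
  have h3 : j < N := by simpa using hj
  refine lt_of_le_of_lt natDegree_pow_le (lt_of_le_of_lt (Nat.mul_le_mul_left j h1) (by omega))

lemma coeff_antideriv_comp_one_sub_X {Y : ℂ[X]} (hY : Y.comp (1 - X) = Y) (j : ℕ) :
    ((antideriv Y).comp (1 - X)).coeff (j + 1) = -(antideriv Y).coeff (j + 1) := by
  have h : derivative ((antideriv Y).comp (1 - X) + antideriv Y) = 0 := by
    rw [derivative_add, derivative_comp, derivative_antideriv, hY]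
    simp
  have h1 := congrArg (fun p => p.coeff j) h
  simp only [coeff_derivative, coeff_zero, coeff_add] at h1
  have h2 : ((j : ℂ) + 1) ≠ 0 := by exact_mod_cast j.succ_ne_zero
  exact eq_neg_of_add_eq_zero_left ((mul_eq_zero.mp h1).resolve_right h2)

lemma natDegree_antideriv_lt {Y : ℂ[X]} {L : ℕ} (hY : Y.natDegree < L) :
    (antideriv Y).natDegree < L + 1 := by
  rw [Nat.lt_succ_iff, natDegree_le_iff_coeff_eq_zero]
  intro i hi
  obtain ⟨i, rfl⟩ : ∃ k, i = k + 1 := ⟨i - 1, by omega⟩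
  rw [coeff_antideriv_succ, coeff_eq_zero_of_natDegree_lt (by omega), zero_div]

end Functional

lemma gbinom_natCast (a k : ℕ) : gbinom (a : ℂ) k = (a.choose k : ℂ) := by
  have h : ((k.factorial : ℕ) : ℂ) ≠ 0 := by exact_mod_cast k.factorial_ne_zero
  rw [gbinom, ← descPochhammer_eval_eq_prod_range, descPochhammer_eval_eq_descFactorial,
    Nat.descFactorial_eq_factorial_mul_choose]
  push_cast
  field_simp

lemma poch_mul_factorial (a k : ℕ) :
    poch ((a : ℂ) + 1) k * (a.factorial : ℕ) = ((a + k).factorial : ℕ) := by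
  induction k with
  | zero => simp [poch]
  | succ k ih =>
    rw [poch, Finset.prod_range_succ, ← poch, ← Nat.add_assoc, Nat.factorial_succ]
    push_cast
    linear_combination ((a : ℂ) + 1 + k) * ih

/-- The matrix whose determinant is `bdet`. -/
noncomputable def bMatrix (μ : ℂ) (n : ℕ) : Matrix (Fin n) (Fin n) ℂ :=
  Matrix.of fun i j : Fin n =>
    (if 0 + i.1 = 1 + j.1 then (-1 : ℂ) else 0)
      + gbinom (μ + ((0 + i.1 : ℕ) : ℂ) + ((1 + j.1 : ℕ) : ℂ) - 2) (1 + j.1)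

lemma bMatrix_even_apply (s n : ℕ) (i j : Fin n) :
    bMatrix (2 * s + 2) n i j
      = (if i.1 = j.1 + 1 then (-1 : ℂ) else 0)
        + ((2 * s + i.1 + (j.1 + 1)).choose (j.1 + 1) : ℂ) := by
  rw [← gbinom_natCast, bMatrix, Matrix.of_apply]
  push_cast
  rw [zero_add, Nat.add_comm 1 j.1]
  congr 2
  ring

lemma last_mul_det_eq {k : ℕ} (A : Matrix (Fin (k + 1)) (Fin (k + 1)) ℂ) (d : Fin (k + 1) → ℂ)
    (h : ℂ) (hd : ∀ j, ∑ i, d i * A i j = if j = Fin.last k then h else 0) :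
    d (Fin.last k) * A.det = h * (A.submatrix Fin.castSucc Fin.castSucc).det := by
  rw [← smul_eq_mul, ← Matrix.det_updateRow_sum, Matrix.det_succ_row _ (Fin.last k),
    Finset.sum_eq_single_of_mem (Fin.last k) (Finset.mem_univ _)]
  · rw [Matrix.updateRow_self]
    have h1 : (A.updateRow (Fin.last k) (∑ i, d i • A i)).submatrix (Fin.last k).succAbove
        (Fin.last k).succAbove = A.submatrix Fin.castSucc Fin.castSucc := by
      ext i j
      simp [Matrix.updateRow_apply, (Fin.castSucc_lt_last i).ne]
    rw [h1]
    have h2 : (∑ i, d i • A i) (Fin.last k) = h := by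
      simpa using hd (Fin.last k)
    rw [h2, ← two_mul, pow_mul, neg_one_sq, one_pow, one_mul]
  · intro j _ hj
    rw [Matrix.updateRow_self]
    have h2 : (∑ i, d i • A i) j = 0 := by
      simpa [hj] using hd j
    rw [h2]
    ring

lemma bdet_even_mul {N : ℕ} (hN : 1 ≤ N) (s : ℕ) :
    bdet (2 * s + 2) (2 * N + 2) 0 1 * ((-1) ^ N * hyperCoeff (s + 2) N N * (2 * N + 2))
      = hyperSym (s + 1) N N * (2 * s + 2 + 2 * N) * bdet (2 * s + 2) (2 * N + 1) 0 1 := by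
  obtain ⟨S, hS0, hS⟩ := exists_hypergeometric_solution (hyperCoeff (s + 2) N) (N := N)
    (q := 2 * s + 2) (by omega) fun j hj => hyperCoeff_eq_zero hN hj
  set Y := symPoly S N with hY
  set E := antideriv Y with hE
  have hdegE : E.natDegree < 2 * N + 2 := natDegree_antideriv_lt (natDegree_symPoly_lt S (by omega))
  have hdegD : (E.comp (1 - Polynomial.X)).natDegree < 2 * N + 2 := by
    refine lt_of_le_of_lt Polynomial.natDegree_comp_le ?_
    have : (1 - Polynomial.X : Polynomial ℂ).natDegree ≤ 1 := by compute_degree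
    nlinarith
  have hτ : ∀ i : ℕ, (symPoly (hyperCoeff (s + 2) N) N).coeff i
      = (i + (2 * s : ℕ) + 3) * (i + 1) * ((i + 2) * E.coeff (i + 2)
        - (i + (2 * s : ℕ) + 2) * E.coeff (i + 1)) := by
    intro i
    have h1 : ((i : ℂ) + 1) ≠ 0 := by exact_mod_cast i.succ_ne_zero
    have h2 : ((i : ℂ) + 1 + 1) ≠ 0 := by exact_mod_cast (i + 1).succ_ne_zero
    rw [← hypergeometric_operator_symPoly hS0 hS, coeff_hypergeometric_operator, hE,
      coeff_antideriv_succ, coeff_antideriv_succ]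
    push_cast
    field_simp
    ring
  obtain ⟨hlow, htop⟩ := add_binomTransform (r := 2 * s) (L := 2 * N + 2) (K := 2 * N)
    (e := E.coeff) (g := hyperSym (s + 1) N N) (by omega) (coeff_antideriv_zero Y)
    (fun l hl => Polynomial.coeff_eq_zero_of_natDegree_lt (by omega)) hτ
    (fun i hi => by
      have := symPoly_hyperCoeff_covariance hN (s + 1) i (2 * N + 2) hi (by omega)
      rwa [show 2 * (s + 1) + 1 = 2 * s + 2 + 1 by ring] at this)
  have hcol : ∀ j : Fin (2 * N + 1 + 1),
      ∑ i : Fin (2 * N + 1 + 1), (E.comp (1 - Polynomial.X)).coeff i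
        * bMatrix (2 * s + 2) (2 * N + 1 + 1) i j
      = E.coeff (j + 1) + binomTransform (2 * s) (2 * N + 2) E.coeff (j + 1) := by
    intro j
    rw [← chooseFunctional_comp_one_sub_X _ _ hdegE, chooseFunctional_eq_sum_range _ _ hdegD]
    simp only [bMatrix_even_apply, mul_add, Finset.sum_add_distrib]
    rw [Fin.sum_univ_eq_sum_range (fun i => (E.comp (1 - Polynomial.X)).coeff i
        * (if i = j.1 + 1 then (-1 : ℂ) else 0)),
      Fin.sum_univ_eq_sum_range (fun i => (E.comp (1 - Polynomial.X)).coeff i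
        * ((2 * s + i + (j.1 + 1)).choose (j.1 + 1) : ℂ))]
    congr 1
    have hneg := coeff_antideriv_comp_one_sub_X (symPoly_comp_one_sub_X S N) j.1
    rw [← hY, ← hE] at hneg
    rw [← neg_eq_iff_eq_neg] at hneg
    simp only [mul_ite, mul_zero, mul_neg, mul_one, Finset.sum_ite_eq', Finset.mem_range]
    rw [hneg]
    split_ifs with h
    · rfl
    · rw [Polynomial.coeff_eq_zero_of_natDegree_lt (by omega)]
  have hdet := last_mul_det_eq (bMatrix (2 * s + 2) (2 * N + 1 + 1))
    (fun i => (E.comp (1 - Polynomial.X)).coeff i)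
    (E.coeff (2 * N + 2) + binomTransform (2 * s) (2 * N + 2) E.coeff (2 * N + 2))
    (fun j => by
      rw [hcol]
      split_ifs with h
      · subst h; rfl
      · have := Fin.val_lt_last h
        exact hlow j (by omega))
  have hlast : (2 * (N : ℂ) + 1) * (E.comp (1 - Polynomial.X)).coeff (2 * N + 1)
      = -((-1) ^ N * S N) := by
    have h1 : (2 * (N : ℂ) + 1) ≠ 0 := by exact_mod_cast (2 * N).succ_ne_zero
    rw [hE, coeff_antideriv_comp_one_sub_X (symPoly_comp_one_sub_X S N), coeff_antideriv_succ,
      coeff_symPoly_top]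
    push_cast
    field_simp
  have hf := hS N
  rw [hS0 (N + 1) (by omega)] at hf
  change (E.comp (1 - Polynomial.X)).coeff (2 * N + 1) * bdet (2 * s + 2) (2 * N + 2) 0 1
    = _ * bdet (2 * s + 2) (2 * N + 1) 0 1 at hdet
  rw [hf, ← htop]
  push_cast
  linear_combination (2 * (N : ℂ) + 2) * (2 * N + 2 * s + 2) * (2 * N + 2 * s + 3)
    * (2 * N + 1) * hdet
    - (2 * (N : ℂ) + 2) * (2 * N + 2 * s + 2) * (2 * N + 2 * s + 3)
      * bdet (2 * s + 2) (2 * N + 2) 0 1 * hlast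

lemma quotient_even {N : ℕ} (hN : 1 ≤ N) (s : ℕ) :
    bdet (2 * s + 2) (2 * N + 2) 0 1 * (N + 1) * poch ((N : ℂ) + 1) N * poch ((s : ℂ) + N + 3) N
      = (2 * s + 2 + 2 * N) * poch ((s : ℂ) + 2 * N + 2) N * poch (2 * (s : ℂ) + 2 * N + 5) N
        * bdet (2 * s + 2) (2 * N + 1) 0 1 := by
  have h := bdet_even_mul hN s
  have hord := hyperSym_order hN (s + 1)
  have p1 := poch_mul_factorial N N
  have p2 := poch_mul_factorial (s + N + 2) N
  have p3 := poch_mul_factorial (s + 2 * N + 1) N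
  have p4 := poch_mul_factorial (2 * s + 2 * N + 4) N
  rw [show N + N = 2 * N by ring] at p1
  rw [show s + N + 2 + N = s + 2 * N + 2 by ring] at p2
  rw [show s + 2 * N + 1 + N = s + 3 * N + 1 by ring] at p3
  rw [show 2 * s + 2 * N + 4 + N = 2 * s + 3 * N + 4 by ring] at p4
  rw [show s + 1 + 1 + 2 * N = s + 2 * N + 2 by ring, show s + 1 + 2 * N = s + 2 * N + 1 by ring,
    show 2 * (s + 1) + 2 + 2 * N = 2 * s + 2 * N + 4 by ring,
    show s + 1 + 3 * N = s + 3 * N + 1 by ring, show s + 1 + 1 + N = s + N + 2 by ring,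
    show 2 * (s + 1) + 2 + 3 * N = 2 * s + 3 * N + 4 by ring, show s + 1 + 1 = s + 2 by ring]
    at hord
  push_cast at p1 p2 p3 p4 hord
  rw [show (s : ℂ) + N + 2 + 1 = s + N + 3 by ring] at p2
  rw [show (s : ℂ) + 2 * N + 1 + 1 = s + 2 * N + 2 by ring] at p3
  rw [show 2 * (s : ℂ) + 2 * N + 4 + 1 = 2 * s + 2 * N + 5 by ring] at p4
  rw [← p1, ← p2, ← p3, ← p4] at hord
  have hfac : ∀ a : ℕ, ((a.factorial : ℕ) : ℂ) ≠ 0 := fun a => by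
    exact_mod_cast a.factorial_ne_zero
  have hneg : ((-1 : ℂ) ^ N) ≠ 0 := pow_ne_zero _ (by norm_num)
  have hK := mul_ne_zero (mul_ne_zero (mul_ne_zero (mul_ne_zero (mul_ne_zero
    (mul_ne_zero (two_ne_zero (α := ℂ)) hneg) (hyperCoeff_ne_zero (M := s + 2) hN le_rfl))
    (hfac N)) (hfac (s + N + 2))) (hfac (s + 2 * N + 1))) (hfac (2 * s + 2 * N + 4))
  apply mul_right_cancel₀ hK
  linear_combination (poch ((N : ℂ) + 1) N * N.factorial * (poch ((s : ℂ) + N + 3) N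
      * (s + N + 2).factorial) * (s + 2 * N + 1).factorial * (2 * s + 2 * N + 4).factorial) * h
    + (2 * s + 2 + 2 * N) * bdet (2 * s + 2) (2 * N + 1) 0 1 * hord

lemma exists_polynomial_eval_eq_bdet (n I J : ℕ) :
    ∃ p : Polynomial ℂ, ∀ μ, p.eval μ = bdet μ n I J := by
  refine ⟨Matrix.det (Matrix.of fun i j : Fin n =>
    (if I + i.1 = J + j.1 then (-1 : Polynomial ℂ) else 0)
      + (∏ l ∈ Finset.range (J + j.1), (Polynomial.X + (Polynomial.C ((I + i.1 : ℕ) : ℂ)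
        + Polynomial.C ((J + j.1 : ℕ) : ℂ) - Polynomial.C 2 - Polynomial.C (l : ℂ))))
        * Polynomial.C (((J + j.1).factorial : ℂ)⁻¹)), fun μ => ?_⟩
  rw [← Polynomial.coe_evalRingHom, RingHom.map_det, bdet]
  congr 1
  ext i j
  simp only [RingHom.mapMatrix_apply, Matrix.map_apply, Matrix.of_apply, Polynomial.coe_evalRingHom,
    Polynomial.eval_add, Polynomial.eval_mul, Polynomial.eval_prod, Polynomial.eval_X,
    Polynomial.eval_C, Polynomial.eval_sub, gbinom, div_eq_mul_inv]
  congr 1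
  · split_ifs <;> simp
  · congr 1
    exact Finset.prod_congr rfl fun l _ => by ring

lemma exists_polynomial_eval_eq_poch (a b : ℂ) (k : ℕ) :
    ∃ p : Polynomial ℂ, ∀ μ, p.eval μ = poch (a * μ + b) k :=
  ⟨∏ i ∈ Finset.range k, (Polynomial.C a * Polynomial.X + Polynomial.C b + Polynomial.C (i : ℂ)),
    fun μ => by simp [poch, Polynomial.eval_prod]⟩

lemma quotient_of_two_le (μ : ℂ) {N : ℕ} (hN : 1 ≤ N) :
    bdet μ (2 * N + 2) 0 1 * (N + 1) * poch ((N : ℂ) + 1) N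
        * poch (1 / 2 * μ + ((N : ℂ) + 2)) N
      = (μ + 2 * N) * poch (1 / 2 * μ + (2 * (N : ℂ) + 1)) N
        * poch (1 * μ + (2 * (N : ℂ) + 3)) N * bdet μ (2 * N + 1) 0 1 := by
  obtain ⟨b, hb⟩ := exists_polynomial_eval_eq_bdet (2 * N + 2) 0 1
  obtain ⟨b', hb'⟩ := exists_polynomial_eval_eq_bdet (2 * N + 1) 0 1
  obtain ⟨p, hp⟩ := exists_polynomial_eval_eq_poch (1 / 2) ((N : ℂ) + 2) N
  obtain ⟨p', hp'⟩ := exists_polynomial_eval_eq_poch (1 / 2) (2 * (N : ℂ) + 1) N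
  obtain ⟨p'', hp''⟩ := exists_polynomial_eval_eq_poch 1 (2 * (N : ℂ) + 3) N
  have key : b * Polynomial.C (((N : ℂ) + 1) * poch ((N : ℂ) + 1) N) * p
      = (Polynomial.X + Polynomial.C (2 * (N : ℂ))) * p' * p'' * b' := by
    refine Polynomial.eq_of_infinite_eval_eq _ _ (Set.infinite_of_injective_forall_mem
      (f := fun s : ℕ => 2 * (s : ℂ) + 2) (fun s t h => by simpa using h) fun s => ?_)
    simp only [Set.mem_ofPred_eq, Polynomial.eval_mul, Polynomial.eval_add, Polynomial.eval_X,
      Polynomial.eval_C, hb, hb', hp, hp', hp'']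
    rw [show 1 / 2 * (2 * (s : ℂ) + 2) + (N + 2) = s + N + 3 by ring,
      show 1 / 2 * (2 * (s : ℂ) + 2) + (2 * N + 1) = s + 2 * N + 2 by ring,
      show 1 * (2 * (s : ℂ) + 2) + (2 * N + 3) = 2 * s + 2 * N + 5 by ring, ← quotient_even hN s]
    ring
  have h := congrArg (Polynomial.eval μ) key
  simp only [Polynomial.eval_mul, Polynomial.eval_add, Polynomial.eval_X,
    Polynomial.eval_C, hb, hb', hp, hp', hp''] at h
  rw [← h]
  ring

/-- The quotient `Q2(n) = b_{2n}(0,1)/b_{2n-1}(0,1)` (cleared form). -/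
theorem quotient_Q2 (μ : ℂ) (n : ℕ) (hn : 1 ≤ n) :
    bdet μ (2 * n) 0 1 * n * poch (n : ℂ) (n - 1) * poch (μ / 2 + n + 1) (n - 1)
      = (μ + 2 * n - 2) * poch (μ / 2 + 2 * n - 1) (n - 1) * poch (μ + 2 * n + 1) (n - 1)
        * bdet μ (2 * n - 1) 0 1 := by
  obtain ⟨N, rfl⟩ : ∃ N, n = N + 1 := ⟨n - 1, by omega⟩
  rcases Nat.eq_zero_or_pos N with rfl | hN
  · simp [bdet, poch, gbinom, Matrix.det_fin_two, Finset.prod_range_succ]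
    ring
  · have h := quotient_of_two_le μ hN
    rw [show 2 * (N + 1) - 1 = 2 * N + 1 by omega, Nat.add_sub_cancel,
      show 2 * (N + 1) = 2 * N + 2 by ring]
    push_cast
    rw [show μ / 2 + ((N : ℂ) + 1) + 1 = 1 / 2 * μ + (N + 2) by ring,
      show μ / 2 + 2 * ((N : ℂ) + 1) - 1 = 1 / 2 * μ + (2 * N + 1) by ring,
      show μ + 2 * ((N : ℂ) + 1) + 1 = 1 * μ + (2 * N + 3) by ring,
      show μ + 2 * ((N : ℂ) + 1) - 2 = μ + 2 * N by ring]
    exact h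
end

section
/- Let μ be a complex number and n ≥ 1 an integer. Then b_{2n}(1,0,μ) · (n)_{n−1} · (μ/2+n+1)_{n−1} = 2 · (μ/2+2n−1)_{n−1} · (μ+2n+1)_{n−1} · b_{2n−1}(1,0,μ). (Equivalently, when the denominators are nonzero, b_{2n}(1,0)/b_{2n−1}(1,0) = 2 (μ/2+2n−1)_{n−1} (μ+2n+1)_{n−1} / ( (n)_{n−1} (μ/2+n+1)_{n−1} ).) -/
section

open Complex (Gamma)

/-- The hypergeometric summand whose sum over `m` is evaluated by `mrrSum_eval`. -/
noncomputable def mrrTerm (X k N : ℂ) (m : ℕ) : ℂ :=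
  (-4) ^ m * Gamma (X + m + k + 1) * (Gamma (2 * k - m + 1))⁻¹ * (Gamma (X + 2 * m - k + 1))⁻¹
    * Gamma (X + m + 1) * Gamma (X + N + m + 1 / 2) * Gamma (2 * N - m)
    * (Gamma (N - m + 1))⁻¹ * (Gamma m)⁻¹ * (Gamma (2 * X + 2 * N + m + 2))⁻¹

/-- A common factor of `mrrTerm` at contiguous parameters. -/
noncomputable def mrrCore (X k N : ℂ) (m : ℕ) : ℂ :=
  (-4) ^ m * Gamma (X + m + k) * (Gamma (2 * k - m + 1))⁻¹ * (Gamma (X + 2 * m - k + 3))⁻¹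
    * Gamma (X + m + 1) * Gamma (X + N + m + 1 / 2) * Gamma (2 * N - m - 2)
    * (Gamma (N - m + 1))⁻¹ * (Gamma m)⁻¹ * (Gamma (2 * X + 2 * N + m + 2))⁻¹

lemma inv_Gamma_rec (s t : ℂ) (h : t = s + 1) : (Gamma s)⁻¹ = s * (Gamma t)⁻¹ := by
  rw [h]; exact Complex.one_div_Gamma_eq_self_mul_one_div_Gamma_add_one s

lemma Gamma_rec (s t : ℂ) (h : t = s + 1) (hs : s ≠ 0) : Gamma t = s * Gamma s := by
  rw [h]; exact Complex.Gamma_add_one s hs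

lemma mrrTerm_eq (X k N : ℂ) (m : ℕ) (h1 : X + m + k ≠ 0) (h2 : 2 * N - m - 1 ≠ 0)
    (h3 : 2 * N - m - 2 ≠ 0) :
    mrrTerm X k N m = (X + m + k) * (X + 2 * m - k + 1) * (X + 2 * m - k + 2)
      * (2 * N - m - 1) * (2 * N - m - 2) * mrrCore X k N m := by
  unfold mrrTerm mrrCore
  rw [Gamma_rec (X + m + k) (X + m + k + 1) rfl h1,
    inv_Gamma_rec (X + 2 * m - k + 1) (X + 2 * m - k + 2) (by ring),
    inv_Gamma_rec (X + 2 * m - k + 2) (X + 2 * m - k + 3) (by ring),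
    Gamma_rec (2 * N - m - 1) (2 * N - m) (by ring) h2,
    Gamma_rec (2 * N - m - 2) (2 * N - m - 1) (by ring) h3]
  ring

lemma mrrTerm_eq₁ (X k N : ℂ) (m : ℕ) (h2 : 2 * N - m - 1 ≠ 0)
    (h3 : 2 * N - m - 2 ≠ 0) :
    mrrTerm X (k - 1) N m = (2 * k - m) * (2 * k - m - 1) * (X + 2 * m - k + 2)
      * (2 * N - m - 1) * (2 * N - m - 2) * mrrCore X k N m := by
  unfold mrrTerm mrrCore
  rw [show X + m + (k - 1) + 1 = X + m + k by ring,
    show X + 2 * m - (k - 1) + 1 = X + 2 * m - k + 2 by ring,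
    show 2 * (k - 1) - m + 1 = 2 * k - m - 1 by ring,
    inv_Gamma_rec (2 * k - m - 1) (2 * k - m) (by ring),
    inv_Gamma_rec (2 * k - m) (2 * k - m + 1) (by ring),
    inv_Gamma_rec (X + 2 * m - k + 2) (X + 2 * m - k + 3) (by ring),
    Gamma_rec (2 * N - m - 1) (2 * N - m) (by ring) h2,
    Gamma_rec (2 * N - m - 2) (2 * N - m - 1) (by ring) h3]
  ring

lemma mrrTerm_eq₂ (X k N : ℂ) (m : ℕ) (h1 : X + m + k ≠ 0) (h2 : X + m + 1 ≠ 0) :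
    mrrTerm (X + 1) (k - 1) (N - 1) m = (X + m + k) * (2 * k - m) * (2 * k - m - 1)
      * (X + m + 1) * (N - m) * mrrCore X k N m := by
  unfold mrrTerm mrrCore
  rw [show X + 1 + m + (k - 1) + 1 = X + m + k + 1 by ring,
    show X + 1 + 2 * m - (k - 1) + 1 = X + 2 * m - k + 3 by ring,
    show 2 * (k - 1) - m + 1 = 2 * k - m - 1 by ring,
    show X + 1 + m + 1 = X + m + 1 + 1 by ring,
    show X + 1 + (N - 1) + m + 1 / 2 = X + N + m + 1 / 2 by ring,
    show 2 * (N - 1) - (m : ℂ) = 2 * N - m - 2 by ring,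
    show N - 1 - m + 1 = N - m by ring,
    show 2 * (X + 1) + 2 * (N - 1) + m + 2 = 2 * X + 2 * N + m + 2 by ring,
    Gamma_rec (X + m + k) (X + m + k + 1) rfl h1,
    inv_Gamma_rec (2 * k - m - 1) (2 * k - m) (by ring),
    inv_Gamma_rec (2 * k - m) (2 * k - m + 1) (by ring),
    Gamma_rec (X + m + 1) (X + m + 1 + 1) rfl h2,
    inv_Gamma_rec (N - m) (N - m + 1) (by ring)]
  ring

/-- The polynomial factor of the Zeilberger certificate for `mrrTerm`. -/
noncomputable def mrrCert (X k N m : ℂ) : ℂ :=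
  (-4*N*X^2 - 24*N^2*X - 4*k*X^2 - 20*k*N*X - 48*k*N^2 - 4*k^2*X - 24*k^2*N + 2*X^2 + 16*N*X
    + 6*k*X + 32*k*N + 8*k^2 - 2*X - 4*k)
  + (4*X^2 + 22*N*X - 12*N^2 + 2*k*X + 42*k*N + 6*k^2 - 5*X + 8*N - 15*k - 1) * m
  + (12*N - 12*k - 2) * m^2

lemma mrrCert_identity (X k N m : ℂ) :
    2 * (2*X + 6*N - 1) * (2*X + 6*N - 3) * (X + 2*N + k - 1)
        * ((X + m + k) * (2*k - m) * (2*k - m - 1) * (X + m + 1) * (N - m))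
      + (4*X + 6*N + 6*k - 1) * (X + k + 1) * (X + 2*N - k + 1)
        * ((2*k - m) * (2*k - m - 1) * (X + 2*m - k + 2) * (2*N - m - 1) * (2*N - m - 2))
      + 2 * (2*k - 1) * (2*X + 2*N + 2*k + 1) * (X + 6*N - 3*k - 1)
        * ((X + m + k) * (X + 2*m - k + 1) * (X + 2*m - k + 2) * (2*N - m - 1) * (2*N - m - 2))
      = -2 * (X + m + k) * (2*k - m) * (N - m) * (X + m + 1) * (2*X + 2*N + 2*m + 1)
          * mrrCert X k N (m + 1)
        - (X + 2*m - k + 1) * (X + 2*m - k + 2) * (2*N - m - 2) * (m - 1) * (2*X + 2*N + m + 1)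
          * mrrCert X k N m := by
  unfold mrrCert
  ring

/-- `m`-th value of the telescoping sequence certifying the recurrence for `mrrTerm`. -/
noncomputable def mrrGosper (X k N : ℂ) (m : ℕ) : ℂ :=
  (X + 2*m - k + 1) * (X + 2*m - k + 2) * (2*N - m - 2) * (m - 1) * (2*X + 2*N + m + 1)
    * mrrCert X k N m * mrrCore X k N m

lemma mrrCore_succ (X k : ℂ) (N m : ℕ) (h1 : X + m + k ≠ 0) (h2 : X + m + 1 ≠ 0)
    (h3 : X + N + m + 1 / 2 ≠ 0) (hm : m ≤ N) (hN : 3 ≤ N) :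
    (X + 2*m - k + 3) * (X + 2*m - k + 4) * (2*N - m - 3) * m * (2*X + 2*N + m + 2)
        * mrrCore X k N (m + 1)
      = -2 * (X + m + k) * (2*k - m) * (N - m) * (X + m + 1) * (2*X + 2*N + 2*m + 1)
        * mrrCore X k N m := by
  unfold mrrCore
  rcases hm.eq_or_lt with rfl | hlt
  · simp
  · have h4 : (2 * N - m - 3 : ℂ) ≠ 0 := by
      obtain ⟨d, rfl⟩ := Nat.exists_eq_add_of_lt hlt
      obtain ⟨e, he⟩ := Nat.exists_eq_add_of_le hN
      have : (2 * ((m + d + 1 : ℕ) : ℂ) - m - 3 : ℂ) = ((e + d + 1 : ℕ) : ℂ) := by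
        have : ((m + d + 1 : ℕ) : ℂ) = ((3 + e : ℕ) : ℂ) := by rw [he]
        push_cast at this ⊢
        linear_combination this
      rw [this]; exact Nat.cast_ne_zero.2 (by omega)
    rw [show X + ((m + 1 : ℕ) : ℂ) + k = X + m + k + 1 by push_cast; ring,
      show 2 * k - ((m + 1 : ℕ) : ℂ) + 1 = 2 * k - m by push_cast; ring,
      show X + 2 * ((m + 1 : ℕ) : ℂ) - k + 3 = X + 2 * m - k + 5 by push_cast; ring,
      show X + ((m + 1 : ℕ) : ℂ) + 1 = X + m + 1 + 1 by push_cast; ring,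
      show X + N + ((m + 1 : ℕ) : ℂ) + 1 / 2 = X + N + m + 1 / 2 + 1 by push_cast; ring,
      show 2 * (N : ℂ) - ((m + 1 : ℕ) : ℂ) - 2 = 2 * N - m - 3 by push_cast; ring,
      show (N : ℂ) - ((m + 1 : ℕ) : ℂ) + 1 = N - m by push_cast; ring,
      show ((m + 1 : ℕ) : ℂ) = m + 1 by push_cast; ring,
      show 2 * X + 2 * N + ((m : ℂ) + 1) + 2 = 2 * X + 2 * N + m + 3 by ring,
      Gamma_rec (X + m + k) (X + m + k + 1) rfl h1,
      Gamma_rec (X + m + 1) (X + m + 1 + 1) rfl h2,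
      Gamma_rec (X + N + m + 1 / 2) (X + N + m + 1 / 2 + 1) rfl h3,
      inv_Gamma_rec (2 * k - m) (2 * k - m + 1) (by ring),
      inv_Gamma_rec (X + 2 * m - k + 3) (X + 2 * m - k + 4) (by ring),
      inv_Gamma_rec (X + 2 * m - k + 4) (X + 2 * m - k + 5) (by ring),
      inv_Gamma_rec (N - m) (N - m + 1) (by ring),
      inv_Gamma_rec m (m + 1) rfl,
      inv_Gamma_rec (2 * X + 2 * N + m + 2) (2 * X + 2 * N + m + 3) (by ring),
      Gamma_rec (2 * N - m - 3) (2 * N - m - 2) (by ring) h4, pow_succ]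
    ring

/-- The sum `∑ m ∈ [1, N], mrrTerm X k N m`. -/
noncomputable def mrrSum (X : ℂ) (k N : ℕ) : ℂ :=
  ∑ i ∈ Finset.range N, mrrTerm X k N (i + 1)

lemma ne_zero_of_generic {X : ℂ} (hX : ∀ z : ℤ, 2 * X ≠ z) {s : ℂ} (z : ℤ)
    (h : 2 * s = 2 * X + z) : s ≠ 0 := by
  rintro rfl
  exact hX (-z) (by push_cast; linear_combination -h)

lemma mrrSum_recurrence {X : ℂ} (hX : ∀ z : ℤ, 2 * X ≠ z) (k N : ℕ) (hN : 2 ≤ N) :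
    2 * (2*X + 6*(N + 1) - 1) * (2*X + 6*(N + 1) - 3) * (X + 2*(N + 1) + (k + 1) - 1)
        * mrrSum (X + 1) k N
      + (4*X + 6*(N + 1) + 6*(k + 1) - 1) * (X + (k + 1) + 1) * (X + 2*(N + 1) - (k + 1) + 1)
        * mrrSum X k (N + 1)
      + 2 * (2*(k + 1) - 1) * (2*X + 2*(N + 1) + 2*(k + 1) + 1)
        * (X + 6*(N + 1) - 3*(k + 1) - 1) * mrrSum X (k + 1) (N + 1) = 0 := by
  have hlast : mrrTerm (X + 1) k N (N + 1) = 0 := by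
    simp [mrrTerm]
  have h0 : mrrSum (X + 1) k N
      = ∑ i ∈ Finset.range (N + 1), mrrTerm (X + 1) k N (i + 1) := by
    rw [Finset.sum_range_succ, hlast, add_zero, mrrSum]
  rw [h0]
  unfold mrrSum
  simp only [Finset.mul_sum]
  rw [← Finset.sum_add_distrib, ← Finset.sum_add_distrib]
  trans ∑ i ∈ Finset.range (N + 1), (mrrGosper X (k + 1) (N + 1) (i + 1 + 1)
      - mrrGosper X (k + 1) (N + 1) (i + 1))
  · refine Finset.sum_congr rfl fun i hi => ?_
    have hi' : i ≤ N := Nat.lt_succ_iff.1 (Finset.mem_range.1 hi)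
    obtain ⟨d, rfl⟩ := Nat.exists_eq_add_of_le hi'
    have g1 : X + ((i + 1 : ℕ) : ℂ) + (k + 1) ≠ 0 :=
      ne_zero_of_generic hX (2 * (i + k + 2)) (by push_cast; ring)
    have g2 : X + ((i + 1 : ℕ) : ℂ) + 1 ≠ 0 :=
      ne_zero_of_generic hX (2 * (i + 2)) (by push_cast; ring)
    have g3 : X + ((i + d + 1 : ℕ) : ℂ) + ((i + 1 : ℕ) : ℂ) + 1 / 2 ≠ 0 :=
      ne_zero_of_generic hX (2 * (2 * i + d + 2) + 1) (by push_cast; ring)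
    have g4 : 2 * (((i + d : ℕ) : ℂ) + 1) - ((i + 1 : ℕ) : ℂ) - 1 ≠ 0 := by
      rw [show 2 * (((i + d : ℕ) : ℂ) + 1) - ((i + 1 : ℕ) : ℂ) - 1 = ((i + 2 * d : ℕ) : ℂ) by
        push_cast; ring]
      exact Nat.cast_ne_zero.2 (by omega)
    have g5 : 2 * (((i + d : ℕ) : ℂ) + 1) - ((i + 1 : ℕ) : ℂ) - 2 ≠ 0 := by
      rw [show 2 * (((i + d : ℕ) : ℂ) + 1) - ((i + 1 : ℕ) : ℂ) - 2
        = ((i + 2 * d - 1 : ℕ) : ℂ) by rw [Nat.cast_sub (by omega)]; push_cast; ring]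
      exact Nat.cast_ne_zero.2 (by omega)
    have e0 := mrrTerm_eq₂ X (k + 1) (((i + d : ℕ) : ℂ) + 1) (i + 1) g1 g2
    have e1 := mrrTerm_eq₁ X (k + 1) (((i + d : ℕ) : ℂ) + 1) (i + 1) g4 g5
    have e2 := mrrTerm_eq X (k + 1) (((i + d : ℕ) : ℂ) + 1) (i + 1) g1 g4 g5
    have hc := mrrCore_succ X (k + 1) (i + d + 1) (i + 1) g1 g2 g3 (by omega) (by omega)
    rw [add_sub_cancel_right] at e0 e1
    rw [add_sub_cancel_right] at e0
    rw [show ((k + 1 : ℕ) : ℂ) = (k : ℂ) + 1 by push_cast; ring]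
    rw [show ((i + d + 1 : ℕ) : ℂ) = ((i + d : ℕ) : ℂ) + 1 by push_cast; ring] at hc ⊢
    rw [e0, e1, e2]
    have hid := mrrCert_identity X (k + 1) (((i + d : ℕ) : ℂ) + 1) ((i + 1 : ℕ) : ℂ)
    unfold mrrGosper
    rw [show ((i + 1 + 1 : ℕ) : ℂ) = ((i + 1 : ℕ) : ℂ) + 1 by push_cast; ring]
    generalize ((i + 1 : ℕ) : ℂ) = m at *
    generalize ((i + d : ℕ) : ℂ) + 1 = M at *
    linear_combination mrrCore X (k + 1) M (i + 1) * hid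
      - mrrCert X (k + 1) M (m + 1) * hc
  · rw [Finset.sum_range_sub (fun i => mrrGosper X (k + 1) (N + 1) (i + 1))]
    simp [mrrGosper, mrrCore]

/-- The closed form of `mrrSum X N N`. -/
noncomputable def mrrVal (X : ℂ) (N : ℕ) : ℂ :=
  (-4) ^ N * Gamma (X + N + 1) * Gamma (X + 3 * N + 1 / 2) * Gamma (X + N + 3 / 2) * N.factorial
    * (Gamma (2 * X + 2 * N + 2))⁻¹ * ((2 * N).factorial : ℂ)⁻¹ * (Gamma (X + 2 * N + 3 / 2))⁻¹

lemma mrrSum_zero (X : ℂ) (N : ℕ) : mrrSum X 0 N = 0 := by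
  refine Finset.sum_eq_zero fun i _ => ?_
  have : 2 * ((0 : ℕ) : ℂ) - ((i + 1 : ℕ) : ℂ) + 1 = -(i : ℂ) := by push_cast; ring
  simp only [mrrTerm, this, Complex.Gamma_neg_nat_eq_zero]
  simp

lemma Gamma_ne_zero_of_generic {X : ℂ} (hX : ∀ z : ℤ, 2 * X ≠ z) {s : ℂ} (z : ℤ)
    (h : 2 * s = 2 * X + z) : Gamma s ≠ 0 := by
  refine Complex.Gamma_ne_zero fun m hm => ?_
  subst hm
  exact hX (-2 * m - z) (by push_cast; linear_combination -h)

lemma mrrTerm_congr {X a b c d e f g h l : ℂ} {k N m : ℕ} (ha : X + m + k + 1 = a)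
    (hb : 2 * (k : ℂ) - m + 1 = b) (hc : X + 2 * m - k + 1 = c) (hd : X + m + 1 = d)
    (he : X + N + m + 1 / 2 = e) (hf : 2 * (N : ℂ) - m = f) (hg : (N : ℂ) - m + 1 = g)
    (hh : (m : ℂ) = h) (hl : 2 * X + 2 * N + m + 2 = l) :
    mrrTerm X k N m = (-4) ^ m * Gamma a * (Gamma b)⁻¹ * (Gamma c)⁻¹ * Gamma d * Gamma e
      * Gamma f * (Gamma g)⁻¹ * (Gamma h)⁻¹ * (Gamma l)⁻¹ := by
  subst_vars
  rfl

lemma mrrVal_congr {X a b c d e : ℂ} {N : ℕ} (ha : X + N + 1 = a) (hb : X + 3 * N + 1 / 2 = b)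
    (hc : X + N + 3 / 2 = c) (hd : 2 * X + 2 * N + 2 = d) (he : X + 2 * N + 3 / 2 = e) :
    mrrVal X N = (-4) ^ N * Gamma a * Gamma b * Gamma c * N.factorial * (Gamma d)⁻¹
      * ((2 * N).factorial : ℂ)⁻¹ * (Gamma e)⁻¹ := by
  subst_vars
  rfl

lemma mrrSum_one {X : ℂ} (hX : ∀ z : ℤ, 2 * X ≠ z) : mrrSum X 1 1 = mrrVal X 1 := by
  have h2 : X + 2 ≠ 0 := ne_zero_of_generic hX 4 (by push_cast; ring)
  have g1 : Gamma (X + 2) ≠ 0 := Gamma_ne_zero_of_generic hX 4 (by push_cast; ring)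
  have g2 : Gamma (X + 7 / 2) ≠ 0 := Gamma_ne_zero_of_generic hX 7 (by push_cast; ring)
  have G2 : Gamma (2 : ℂ) = 1 := by
    rw [show (2 : ℂ) = (1 : ℕ) + 1 by norm_num, Complex.Gamma_nat_eq_factorial]
    simp
  have F1 : (Nat.factorial 1 : ℂ) = 1 := by simp
  have F2 : ((2 * 1).factorial : ℂ) = 2 := by norm_num [Nat.factorial]
  rw [mrrSum, Finset.sum_range_one, zero_add,
    mrrTerm_congr (a := X + 3) (b := 2) (c := X + 2) (d := X + 2) (e := X + 5 / 2) (f := 1)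
      (g := 1) (h := 1) (l := 2 * X + 5),
    mrrVal_congr (a := X + 2) (b := X + 7 / 2) (c := X + 5 / 2) (d := 2 * X + 4)
      (e := X + 7 / 2), F1, F2, G2, Complex.Gamma_one,
    Gamma_rec (X + 2) (X + 3) (by ring) h2, inv_Gamma_rec (2 * X + 4) (2 * X + 5) (by ring)]
  · generalize Gamma (X + 7 / 2) = A at g2 ⊢
    field_simp
    ring
  all_goals push_cast; ring

lemma mrrSum_two {X : ℂ} (hX : ∀ z : ℤ, 2 * X ≠ z) :
    mrrSum X 1 2 = 0 ∧ mrrSum X 2 2 = mrrVal X 2 := by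
  have G : ∀ n : ℕ, Gamma ((n : ℂ) + 1) = n.factorial := Complex.Gamma_nat_eq_factorial
  have G1 : Gamma (1 : ℂ) = 1 := Complex.Gamma_one
  have G2 : Gamma (2 : ℂ) = 1 := by rw [show (2 : ℂ) = (1 : ℕ) + 1 by norm_num, G]; simp
  have G3 : Gamma (3 : ℂ) = 2 := by
    rw [show (3 : ℂ) = (2 : ℕ) + 1 by norm_num, G]; norm_num [Nat.factorial]
  have G4 : Gamma (4 : ℂ) = 6 := by
    rw [show (4 : ℂ) = (3 : ℕ) + 1 by norm_num, G]; norm_num [Nat.factorial]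
  have F2 : (Nat.factorial 2 : ℂ) = 2 := by simp
  have F4 : ((2 * 2).factorial : ℂ) = 24 := by norm_num [Nat.factorial]
  have g1 : Gamma (X + 2) ≠ 0 := Gamma_ne_zero_of_generic hX 4 (by push_cast; ring)
  have g2 : Gamma (X + 11 / 2) ≠ 0 := Gamma_ne_zero_of_generic hX 11 (by push_cast; ring)
  have h2 : X + 2 ≠ 0 := ne_zero_of_generic hX 4 (by push_cast; ring)
  have h3 : X + 3 ≠ 0 := ne_zero_of_generic hX 6 (by push_cast; ring)
  have h4 : X + 4 ≠ 0 := ne_zero_of_generic hX 8 (by push_cast; ring)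
  have h5 : X + 7 / 2 ≠ 0 := ne_zero_of_generic hX 7 (by push_cast; ring)
  have h6 : X + 11 / 2 ≠ 0 := ne_zero_of_generic hX 11 (by push_cast; ring)
  have e1 := Gamma_rec (X + 2) (X + 3) (by ring) h2
  have e2 := Gamma_rec (X + 3) (X + 4) (by ring) h3
  have e3 := Gamma_rec (X + 4) (X + 5) (by ring) h4
  have e4 := Gamma_rec (X + 7 / 2) (X + 9 / 2) (by ring) h5
  have e5 := Gamma_rec (X + 11 / 2) (X + 13 / 2) (by ring) h6
  have e6 := inv_Gamma_rec (2 * X + 7) (2 * X + 8) (by ring)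
  have e7 := inv_Gamma_rec (2 * X + 6) (2 * X + 7) (by ring)
  have e8 := inv_Gamma_rec (X + 1) (X + 2) (by ring)
  constructor
  · rw [mrrSum, Finset.sum_range_succ, Finset.sum_range_one,
      mrrTerm_congr (a := X + 3) (b := 2) (c := X + 2) (d := X + 2) (e := X + 7 / 2) (f := 3)
        (g := 2) (h := 1) (l := 2 * X + 7),
      mrrTerm_congr (a := X + 4) (b := 1) (c := X + 4) (d := X + 3) (e := X + 9 / 2) (f := 2)
        (g := 1) (h := 2) (l := 2 * X + 8), G1, G2, G3, e4, e6, e2, e1]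
    · field_simp
      ring
    all_goals push_cast; ring
  · rw [mrrSum, Finset.sum_range_succ, Finset.sum_range_one,
      mrrTerm_congr (a := X + 4) (b := 4) (c := X + 1) (d := X + 2) (e := X + 7 / 2) (f := 3)
        (g := 2) (h := 1) (l := 2 * X + 7),
      mrrTerm_congr (a := X + 5) (b := 3) (c := X + 3) (d := X + 3) (e := X + 9 / 2) (f := 2)
        (g := 1) (h := 2) (l := 2 * X + 8),
      mrrVal_congr (a := X + 3) (b := X + 13 / 2) (c := X + 7 / 2) (d := 2 * X + 6)
        (e := X + 11 / 2), F2, F4, G1, G2, G3, G4, e4, e7, e6, e3, e2, e5, e8, e1]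
    · generalize Gamma (X + 11 / 2) = A at g2 ⊢
      field_simp
      ring
    all_goals push_cast; ring

lemma generic_add_one {X : ℂ} (hX : ∀ z : ℤ, 2 * X ≠ z) (z : ℤ) : 2 * (X + 1) ≠ z := fun h =>
  hX (z - 2) (by push_cast; linear_combination h)

lemma mrrVal_succ {X : ℂ} (hX : ∀ z : ℤ, 2 * X ≠ z) (N : ℕ) :
    (2*X + 6*(N + 1) - 1) * (2*X + 6*(N + 1) - 3) * mrrVal (X + 1) N
      + (2*N + 1) * (2*X + 4*N + 5) * mrrVal X (N + 1) = 0 := by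
  have h1 : X + 3 * N + 3 / 2 ≠ 0 := ne_zero_of_generic hX (6 * N + 3) (by push_cast; ring)
  have h2 : X + 3 * N + 5 / 2 ≠ 0 := ne_zero_of_generic hX (6 * N + 5) (by push_cast; ring)
  have h3 : X + 2 * N + 5 / 2 ≠ 0 := ne_zero_of_generic hX (4 * N + 5) (by push_cast; ring)
  have hf : ((2 * N).factorial : ℂ) ≠ 0 := Nat.cast_ne_zero.2 (Nat.factorial_ne_zero _)
  have c1 : (N : ℂ) + 1 ≠ 0 := Nat.cast_add_one_ne_zero N
  have c2 : 2 * (N : ℂ) + 1 ≠ 0 := by exact_mod_cast Nat.succ_ne_zero (2 * N)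
  have f1 : (((2 * (N + 1)).factorial : ℕ) : ℂ)⁻¹
      = (((2 * N).factorial : ℕ) : ℂ)⁻¹ * (2 * (N : ℂ) + 1)⁻¹ * (2 * ((N : ℂ) + 1))⁻¹ := by
    rw [show 2 * (N + 1) = 2 * N + 1 + 1 by ring, Nat.factorial_succ, Nat.factorial_succ]
    push_cast
    rw [show (2 * N + 1 + 1 : ℂ) = 2 * (N + 1) by ring]
    field_simp
  unfold mrrVal
  rw [f1, Nat.factorial_succ]
  push_cast
  rw [show X + 1 + (N : ℂ) + 1 = X + N + 2 by ring, show X + (N + 1 : ℂ) + 1 = X + N + 2 by ring,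
    show X + 1 + 3 * (N : ℂ) + 1 / 2 = X + 3 * N + 3 / 2 by ring,
    show X + 3 * (N + 1 : ℂ) + 1 / 2 = X + 3 * N + 7 / 2 by ring,
    show X + 1 + (N : ℂ) + 3 / 2 = X + N + 5 / 2 by ring,
    show X + (N + 1 : ℂ) + 3 / 2 = X + N + 5 / 2 by ring,
    show 2 * (X + 1) + 2 * (N : ℂ) + 2 = 2 * X + 2 * N + 4 by ring,
    show 2 * X + 2 * (N + 1 : ℂ) + 2 = 2 * X + 2 * N + 4 by ring,
    show X + 1 + 2 * (N : ℂ) + 3 / 2 = X + 2 * N + 5 / 2 by ring,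
    show X + 2 * (N + 1 : ℂ) + 3 / 2 = X + 2 * N + 7 / 2 by ring,
    Gamma_rec (X + 3 * N + 5 / 2) (X + 3 * N + 7 / 2) (by ring) h2,
    Gamma_rec (X + 3 * N + 3 / 2) (X + 3 * N + 5 / 2) (by ring) h1,
    inv_Gamma_rec (X + 2 * N + 5 / 2) (X + 2 * N + 7 / 2) (by ring), pow_succ]
  field_simp
  ring

/-- The sums `mrrSum X k N` vanish for `k < N` and have a closed form for `k = N`. -/
theorem mrrSum_eval (N : ℕ) (hN : 1 ≤ N) : ∀ X : ℂ, (∀ z : ℤ, 2 * X ≠ z) →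
    (∀ k < N, mrrSum X k N = 0) ∧ mrrSum X N N = mrrVal X N := by
  induction N, hN using Nat.le_induction with
  | base =>
    intro X hX
    refine ⟨fun k hk => ?_, mrrSum_one hX⟩
    obtain rfl : k = 0 := by omega
    exact mrrSum_zero X 1
  | succ N hN ih =>
    intro X hX
    rcases hN.eq_or_lt with rfl | hN2
    · refine ⟨fun k hk => ?_, (mrrSum_two hX).2⟩
      interval_cases k
      · exact mrrSum_zero X 2
      · exact (mrrSum_two hX).1
    obtain ⟨ih0, ih1⟩ := ih (X + 1) (generic_add_one hX)
    have coeff : ∀ k ≤ N, (2 * (2*(k + 1) - 1) * (2*X + 2*(N + 1) + 2*(k + 1) + 1)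
        * (X + 6*(N + 1) - 3*(k + 1) - 1) : ℂ) ≠ 0 := by
      intro k hk
      have c1 : (2 * ((k : ℂ) + 1) - 1) ≠ 0 := by
        rw [show 2 * ((k : ℂ) + 1) - 1 = ((2 * k + 1 : ℕ) : ℂ) by push_cast; ring]
        exact Nat.cast_ne_zero.2 (by omega)
      have c2 : 2*X + 2*((N : ℂ) + 1) + 2*(k + 1) + 1 ≠ 0 := fun h =>
        hX (-(2 * (N + 1) + 2 * (k + 1) + 1)) (by push_cast; linear_combination h)
      have c3 : X + 6*((N : ℂ) + 1) - 3*(k + 1) - 1 ≠ 0 :=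
        ne_zero_of_generic hX (2 * (6*(N + 1) - 3*(k + 1) - 1)) (by push_cast; ring)
      exact mul_ne_zero (mul_ne_zero (mul_ne_zero two_ne_zero c1) c2) c3
    have zero : ∀ k < N + 1, mrrSum X k (N + 1) = 0 := by
      intro k
      induction k with
      | zero => exact fun _ => mrrSum_zero X _
      | succ k ihk =>
        intro hk
        have := mrrSum_recurrence hX k N hN2
        rw [ih0 k (by omega), ihk (by omega), mul_zero, mul_zero, zero_add, zero_add] at this
        exact (mul_eq_zero.1 this).resolve_left (coeff k (by omega))
    refine ⟨zero, ?_⟩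
    have hrec := mrrSum_recurrence hX N N hN2
    rw [zero N (by omega), ih1] at hrec
    have hv := mrrVal_succ hX N
    refine mul_left_cancel₀ (coeff N le_rfl) ?_
    linear_combination hrec - 2 * (X + 3 * N + 2) * hv

lemma gbinom_zero (x : ℂ) : gbinom x 0 = 1 := by simp [gbinom]

lemma gbinom_succ (x : ℂ) (k : ℕ) : gbinom x (k + 1) = gbinom x k * (x - k) / (k + 1) := by
  unfold gbinom
  rw [Finset.prod_range_succ, Nat.factorial_succ]
  push_cast
  field_simp

lemma gbinom_add_one (x : ℂ) (k : ℕ) :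
    gbinom (x + 1) (k + 1) = gbinom x (k + 1) + gbinom x k := by
  have hk : (k : ℂ) + 1 ≠ 0 := Nat.cast_add_one_ne_zero k
  have h : gbinom (x + 1) (k + 1) = (x + 1) * gbinom x k / (k + 1) := by
    unfold gbinom
    rw [Finset.prod_range_succ', Nat.factorial_succ]
    push_cast
    simp only [add_sub_add_right_eq_sub, sub_zero]
    field_simp
  rw [h, gbinom_succ]
  field_simp
  ring

lemma gbinom_natCast_s15 (m k : ℕ) : gbinom (m : ℂ) k = m.choose k := by
  induction m generalizing k with
  | zero =>
    cases k with
    | zero => simp [gbinom_zero]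
    | succ k => simp [gbinom, Finset.prod_range_succ']
  | succ m ih =>
    cases k with
    | zero => simp [gbinom_zero]
    | succ k =>
      push_cast
      rw [gbinom_add_one, ih, ih, Nat.choose_succ_succ]
      push_cast
      ring

lemma gbinom_reflect (y : ℂ) (k : ℕ) : gbinom (k - 1 - y) k = (-1) ^ k * gbinom y k := by
  unfold gbinom
  rw [← Finset.prod_range_reflect, ← mul_div_assoc]
  congr 1
  rw [show (-1 : ℂ) ^ k = ∏ _i ∈ Finset.range k, (-1 : ℂ) by simp, ← Finset.prod_mul_distrib]
  refine Finset.prod_congr rfl fun i hi => ?_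
  have hi := Finset.mem_range.1 hi
  rw [show k - 1 - i = k - (i + 1) by omega, Nat.cast_sub (by omega)]
  push_cast
  ring

lemma gbinom_eq_Gamma {y : ℂ} (h : Gamma (y + 1) ≠ 0) (k : ℕ) :
    gbinom y k = Gamma (y + 1) * (Gamma (k + 1))⁻¹ * (Gamma (y - k + 1))⁻¹ := by
  induction k with
  | zero => simp [gbinom_zero, h]
  | succ k ih =>
    have hk : (k : ℂ) + 1 ≠ 0 := Nat.cast_add_one_ne_zero k
    rw [gbinom_succ, ih]
    push_cast
    rw [Gamma_rec (k + 1) (k + 1 + 1) rfl hk, inv_Gamma_rec (y - (k + 1) + 1) (y - k + 1) (by ring)]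
    field_simp
    ring

lemma poch_mul_Gamma {x : ℂ} (h : ∀ i : ℕ, x + i ≠ 0) (k : ℕ) :
    poch x k * Gamma x = Gamma (x + k) := by
  induction k with
  | zero => simp [poch]
  | succ k ih =>
    rw [Gamma_rec (x + k) (x + (k + 1 : ℕ)) (by push_cast; ring) (h k), ← ih, poch,
      Finset.prod_range_succ, ← poch]
    ring

lemma fwdDiff_iter_gbinom (a : ℂ) (j r : ℕ) (y : ℂ) :
    (fwdDiff (1 : ℂ))^[r] (fun x => gbinom (x + a) j) y
      = if r ≤ j then gbinom (y + a) (j - r) else 0 := by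
  induction r generalizing j with
  | zero => simp
  | succ r ih =>
    rw [Function.iterate_succ_apply]
    cases j with
    | zero =>
      have h : fwdDiff (1 : ℂ) (fun x => gbinom (x + a) 0) = fun _ => 0 := by
        funext x
        simp [fwdDiff, gbinom_zero]
      have h0 : ∀ r : ℕ, (fwdDiff (1 : ℂ))^[r] (fun _ => (0 : ℂ)) = fun _ => 0 := by
        intro r
        induction r with
        | zero => rfl
        | succ r ihr =>
          rw [Function.iterate_succ_apply,
            show fwdDiff (1 : ℂ) (fun _ => (0 : ℂ)) = fun _ => 0 by funext x; simp [fwdDiff], ihr]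
      rw [h, h0]
      simp
    | succ j =>
      have h : fwdDiff (1 : ℂ) (fun x => gbinom (x + a) (j + 1)) = fun x => gbinom (x + a) j := by
        funext x
        rw [fwdDiff, show x + 1 + a = x + a + 1 by ring, gbinom_add_one]
        ring
      rw [h, ih]
      simp

/-- The weights of the functional `f ↦ ∑ m, γ m * (Δ ^ (m + 1) f) (m + 1)`. -/
noncomputable def diffWeight (γ : ℕ → ℂ) (N i : ℕ) : ℂ :=
  ∑ m ∈ Finset.range N,
    γ (m + 1) * if m + 2 ≤ i then (-1) ^ i * ((m + 2).choose (i - (m + 2)) : ℂ) else 0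

lemma sum_diffWeight_mul (γ : ℕ → ℂ) (N : ℕ) (f : ℂ → ℂ) :
    ∑ i ∈ Finset.range (2 * N + 3), diffWeight γ N i * f i
      = ∑ m ∈ Finset.range N, γ (m + 1) * (fwdDiff (1 : ℂ))^[m + 2] f ((m + 2 : ℕ) : ℂ) := by
  simp only [diffWeight, Finset.sum_mul]
  rw [Finset.sum_comm]
  refine Finset.sum_congr rfl fun m hm => ?_
  have hm := Finset.mem_range.1 hm
  simp only [mul_assoc]
  rw [← Finset.mul_sum, fwdDiff_iter_eq_sum_shift]
  congr 1
  rw [Finset.range_eq_Ico, ← Finset.sum_Ico_consecutive _ (Nat.zero_le (m + 2))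
    (show m + 2 ≤ 2 * N + 3 by omega), Finset.sum_eq_zero, zero_add, Finset.sum_Ico_eq_sum_range]
  · symm
    rw [← Finset.sum_subset (Finset.range_subset_range.2
      (show m + 2 + 1 ≤ 2 * N + 3 - (m + 2) by omega))]
    · refine Finset.sum_congr rfl fun l hl => ?_
      have hl := Finset.mem_range.1 hl
      have hs : (-1 : ℂ) ^ (m + 2 - l) = (-1) ^ (m + 2 + l) := by
        rw [show m + 2 + l = m + 2 - l + 2 * l by omega, pow_add, pow_mul]
        simp
      simp only [zsmul_eq_mul, nsmul_eq_mul]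
      push_cast
      rw [hs]
      simp
    · intro l _ hl
      have hl : m + 2 < l := by simpa using hl
      rw [if_pos (by omega), Nat.add_sub_cancel_left, Nat.choose_eq_zero_of_lt hl]
      simp
  · intro i hi
    have hi := Finset.mem_Ico.1 hi
    rw [if_neg (by omega), zero_mul]

lemma sum_diffWeight_mul_gbinom (γ : ℕ → ℂ) (N j : ℕ) :
    ∑ i ∈ Finset.range (2 * N + 3), diffWeight γ N i * ((-1) ^ j * gbinom (i : ℂ) j)
      = diffWeight γ N j := by
  have h := sum_diffWeight_mul γ N (fun x => gbinom (x + 0) j)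
  simp only [fwdDiff_iter_gbinom] at h
  simp only [add_zero, gbinom_natCast_s15] at h
  simp only [gbinom_natCast_s15, mul_left_comm _ ((-1 : ℂ) ^ j)]
  rw [← Finset.mul_sum, h, diffWeight, Finset.mul_sum]
  refine Finset.sum_congr rfl fun m _ => ?_
  split_ifs <;> ring

lemma diffWeight_zero (γ : ℕ → ℂ) (N : ℕ) : diffWeight γ N 0 = 0 := by simp [diffWeight]

lemma diffWeight_last (γ : ℕ → ℂ) (N : ℕ) (hN : 1 ≤ N) :
    diffWeight γ N (2 * N + 2) = γ N := by
  obtain ⟨N, rfl⟩ := Nat.exists_eq_add_of_le' hN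
  rw [diffWeight, Finset.sum_range_succ, Finset.sum_eq_zero, zero_add]
  · rw [if_pos (by omega), show 2 * (N + 1) + 2 - (N + 2) = N + 2 by omega, Nat.choose_self,
      pow_add, pow_mul]
    simp
  · intro m hm
    have hm := Finset.mem_range.1 hm
    rw [if_pos (by omega), Nat.choose_eq_zero_of_lt (by omega)]
    simp

open Polynomial in
lemma coeff_comp_linear {p q : ℂ[X]} {d : ℕ} (hp : p.natDegree ≤ d) (hq : q.natDegree = 1) :
    (p.comp q).coeff d = p.coeff d * q.leadingCoeff ^ d := by
  rcases hp.lt_or_eq with h | rfl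
  · rw [coeff_eq_zero_of_natDegree_lt h, zero_mul, coeff_eq_zero_of_natDegree_lt]
    rwa [natDegree_comp, hq, mul_one]
  · have := coeff_comp_degree_mul_degree (p := p) (q := q) (by omega)
    rwa [hq, mul_one] at this

open Polynomial in
/-- A polynomial antisymmetric about `a / 2` has vanishing top coefficient in even degree. -/
lemma coeff_even_eq_zero_of_odd {p : ℂ[X]} {a : ℂ} (ho : p.comp (C a - X) = -p) {d : ℕ}
    (hp : p.natDegree ≤ 2 * d) : p.coeff (2 * d) = 0 := by
  have hX : (C a - X : ℂ[X]) = C (-1) * X + C a := by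
    rw [C_neg, C_1]
    ring
  have h1 : (C a - X : ℂ[X]).natDegree = 1 := by rw [hX, natDegree_linear (by norm_num)]
  have h2 : (C a - X : ℂ[X]).leadingCoeff = -1 := by rw [hX, leadingCoeff_linear (by norm_num)]
  have h := coeff_comp_linear hp h1
  rw [ho, h2, pow_mul, coeff_neg] at h
  norm_num at h
  linear_combination -h / 2

open Polynomial in
/-- A functional on polynomials antisymmetric about `a / 2` is determined by its values on a family
`ψ k` of such polynomials of degree `2 * k + 1`. -/
lemma functional_eq_zero_of_odd {L : ℂ[X] →ₗ[ℂ] ℂ} {a : ℂ} {ψ : ℕ → ℂ[X]} {N : ℕ}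
    (hodd : ∀ k, (ψ k).comp (C a - X) = -ψ k) (hdeg : ∀ k, (ψ k).natDegree ≤ 2 * k + 1)
    (hlead : ∀ k, (ψ k).coeff (2 * k + 1) ≠ 0) (hL : ∀ k < N, L (ψ k) = 0) (K : ℕ) (hK : K ≤ N)
    (p : ℂ[X]) (ho : p.comp (C a - X) = -p) (hp : p.natDegree ≤ 2 * K) : L p = 0 := by
  induction K generalizing p with
  | zero =>
    have h0 := coeff_even_eq_zero_of_odd ho hp
    rw [eq_C_of_natDegree_le_zero hp, h0, C_0, map_zero]
  | succ K ih =>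
    have h1 : p.natDegree ≤ 2 * K + 1 :=
      natDegree_le_pred hp (coeff_even_eq_zero_of_odd ho hp)
    set c := p.coeff (2 * K + 1) / (ψ K).coeff (2 * K + 1) with hc
    have h2 : (p - c • ψ K).natDegree ≤ 2 * K := by
      refine natDegree_le_pred (n := 2 * K + 1) ((natDegree_sub_le_of_le h1
        ((natDegree_smul_le _ _).trans (hdeg K))).trans (max_self _).le) ?_
      rw [coeff_sub, coeff_smul, smul_eq_mul, hc, div_mul_cancel₀ _ (hlead K), sub_self]
    have h3 := ih (by omega) (p - c • ψ K) (by rw [sub_comp, smul_comp, ho, hodd, smul_neg]; abel) h2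
    rwa [map_sub, map_smul, hL K (by omega), smul_zero, sub_zero] at h3

open Polynomial in
lemma functional_top_of_odd {L : ℂ[X] →ₗ[ℂ] ℂ} {a : ℂ} {ψ : ℕ → ℂ[X]} {N : ℕ}
    (hodd : ∀ k, (ψ k).comp (C a - X) = -ψ k) (hdeg : ∀ k, (ψ k).natDegree ≤ 2 * k + 1)
    (hlead : ∀ k, (ψ k).coeff (2 * k + 1) ≠ 0) (hL : ∀ k < N, L (ψ k) = 0) (c : ℂ)
    (p : ℂ[X]) (ho : p.comp (C a - X) = -p) (hp : p.natDegree ≤ 2 * N + 1)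
    (hc : p.coeff (2 * N + 1) = c * (ψ N).coeff (2 * N + 1)) : L p = c * L (ψ N) := by
  have h2 : (p - c • ψ N).natDegree ≤ 2 * N := by
    refine natDegree_le_pred (n := 2 * N + 1) ((natDegree_sub_le_of_le hp
      ((natDegree_smul_le _ _).trans (hdeg N))).trans (max_self _).le) ?_
    rw [coeff_sub, coeff_smul, smul_eq_mul, hc, sub_self]
  have h3 := functional_eq_zero_of_odd hodd hdeg hlead hL N le_rfl (p - c • ψ N)
    (by rw [sub_comp, smul_comp, ho, hodd, smul_neg]; abel) h2
  rw [map_sub, map_smul, smul_eq_mul] at h3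
  exact sub_eq_zero.1 h3

open Polynomial in
/-- The polynomial `x ↦ gbinom (x + a) j`. -/
noncomputable def gbinomPoly (a : ℂ) (j : ℕ) : ℂ[X] :=
  (C ((j.factorial : ℂ)⁻¹) * descPochhammer ℂ j).comp (X + C a)

open Polynomial in
lemma eval_gbinomPoly (a : ℂ) (j : ℕ) (x : ℂ) :
    (gbinomPoly a j).eval x = gbinom (x + a) j := by
  simp only [gbinomPoly, eval_comp, eval_mul, eval_C, eval_add, eval_X,
    descPochhammer_eval_eq_prod_range, gbinom]
  rw [mul_comm, div_eq_mul_inv]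

open Polynomial in
lemma natDegree_gbinomPoly (a : ℂ) (j : ℕ) : (gbinomPoly a j).natDegree = j := by
  have h : (j.factorial : ℂ)⁻¹ ≠ 0 := inv_ne_zero (Nat.cast_ne_zero.2 (Nat.factorial_ne_zero j))
  rw [gbinomPoly, natDegree_comp, natDegree_X_add_C, mul_one, natDegree_C_mul h,
    descPochhammer_natDegree]

open Polynomial in
lemma coeff_gbinomPoly (a : ℂ) (j : ℕ) : (gbinomPoly a j).coeff j = (j.factorial : ℂ)⁻¹ := by
  have h := (monic_descPochhammer ℂ j).coeff_natDegree
  rw [descPochhammer_natDegree] at h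
  rw [gbinomPoly, coeff_comp_linear ((natDegree_C_mul_le _ _).trans
    (descPochhammer_natDegree (R := ℂ) j).le) (natDegree_X_add_C a), leadingCoeff_X_add_C, one_pow,
    mul_one, coeff_C_mul, h, mul_one]

open Polynomial in
lemma gbinomPoly_odd (μ : ℂ) (k : ℕ) :
    (gbinomPoly ((μ - 1) / 2 + k) (2 * k + 1)).comp (C (1 - μ) - X)
      = -gbinomPoly ((μ - 1) / 2 + k) (2 * k + 1) := by
  refine Polynomial.funext fun x => ?_
  have h := gbinom_reflect (x + ((μ - 1) / 2 + k)) (2 * k + 1)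
  rw [pow_succ, pow_mul, neg_one_sq, one_pow, one_mul, neg_one_mul] at h
  rw [eval_comp, eval_neg, eval_gbinomPoly, eval_gbinomPoly, ← h]
  congr 1
  simp only [eval_sub, eval_C, eval_X]
  push_cast
  ring

open Polynomial in
/-- The polynomial `x ↦ gbinom (x + μ - 2 + j) j - (-1) ^ j * gbinom x j`. -/
noncomputable def columnPoly (μ : ℂ) (j : ℕ) : ℂ[X] :=
  gbinomPoly (μ - 2 + j) j - C ((-1) ^ j) * gbinomPoly 0 j

open Polynomial in
lemma eval_columnPoly (μ : ℂ) (j : ℕ) (x : ℂ) :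
    (columnPoly μ j).eval x = gbinom (x + (μ - 2 + j)) j - (-1) ^ j * gbinom x j := by
  rw [columnPoly, eval_sub, eval_mul, eval_C, eval_gbinomPoly, eval_gbinomPoly, add_zero]

open Polynomial in
lemma columnPoly_odd (μ : ℂ) (j : ℕ) :
    (columnPoly μ j).comp (C (1 - μ) - X) = -columnPoly μ j := by
  refine Polynomial.funext fun x => ?_
  have h1 := gbinom_reflect x j
  have h2 := gbinom_reflect (1 - μ - x) j
  rw [eval_comp, eval_neg, eval_columnPoly, eval_columnPoly]
  simp only [eval_sub, eval_C, eval_X]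
  rw [show 1 - μ - x + (μ - 2 + j) = j - 1 - x by ring, h1,
    show x + (μ - 2 + j) = j - 1 - (1 - μ - x) by ring, h2]
  ring

open Polynomial in
lemma natDegree_columnPoly_le (μ : ℂ) (j : ℕ) : (columnPoly μ j).natDegree ≤ j :=
  (natDegree_sub_le_of_le (natDegree_gbinomPoly _ _).le
    ((natDegree_C_mul_le _ _).trans (natDegree_gbinomPoly _ _).le)).trans (max_self _).le

open Polynomial in
lemma coeff_columnPoly (μ : ℂ) (N : ℕ) :
    (columnPoly μ (2 * N + 1)).coeff (2 * N + 1) = 2 * ((2 * N + 1).factorial : ℂ)⁻¹ := by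
  rw [columnPoly, coeff_sub, coeff_C_mul, coeff_gbinomPoly, coeff_gbinomPoly, pow_succ, pow_mul,
    neg_one_sq, one_pow]
  ring

open Polynomial in
/-- The functional `p ↦ ∑ i, w i * p(i)` on polynomials. -/
noncomputable def weightFunctional (w : ℕ → ℂ) (n : ℕ) : ℂ[X] →ₗ[ℂ] ℂ :=
  ∑ i ∈ Finset.range n, w i • Polynomial.leval (i : ℂ)

lemma weightFunctional_apply (w : ℕ → ℂ) (n : ℕ) (p : Polynomial ℂ) :
    weightFunctional w n p = ∑ i ∈ Finset.range n, w i * p.eval (i : ℂ) := by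
  simp [weightFunctional]

/-- The part of `mrrTerm X k N m` that does not depend on `k`. -/
noncomputable def mrrWeight (X : ℂ) (N m : ℕ) : ℂ :=
  (-4) ^ m * Gamma (X + m + 1) * Gamma (X + N + m + 1 / 2) * Gamma (2 * N - m)
    * (Gamma (N - m + 1))⁻¹ * (Gamma m)⁻¹ * (Gamma (2 * X + 2 * N + m + 2))⁻¹

lemma mrrTerm_eq_mrrWeight_mul {X : ℂ} (hX : ∀ z : ℤ, 2 * X ≠ z) (k N m : ℕ) :
    mrrTerm X k N m
      = mrrWeight X N m * if m ≤ 2 * k then gbinom (X + m + k) (2 * k - m) else 0 := by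
  unfold mrrTerm mrrWeight
  split_ifs with h
  · rw [gbinom_eq_Gamma (Gamma_ne_zero_of_generic hX (2 * (m + k + 1)) (by push_cast; ring)),
      Nat.cast_sub h]
    push_cast
    rw [show X + m + k - (2 * k - m) + 1 = X + 2 * m - k + 1 by ring]
    ring
  · have h0 : 2 * (k : ℂ) - m + 1 = -((m - 2 * k - 1 : ℕ) : ℂ) := by
      rw [Nat.cast_sub (by omega), Nat.cast_sub (by omega)]
      push_cast
      ring
    rw [h0, Complex.Gamma_neg_nat_eq_zero]
    simp

lemma weightFunctional_gbinomPoly {μ X : ℂ} (hμ : μ = 2 * X - 1) (hX : ∀ z : ℤ, 2 * X ≠ z)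
    (k N : ℕ) :
    weightFunctional (diffWeight (mrrWeight X N) N) (2 * N + 3)
      (gbinomPoly ((μ - 1) / 2 + k) (2 * k + 1)) = mrrSum X k N := by
  simp only [weightFunctional_apply, eval_gbinomPoly]
  rw [sum_diffWeight_mul _ _ fun x => gbinom (x + ((μ - 1) / 2 + k)) (2 * k + 1), mrrSum]
  refine Finset.sum_congr rfl fun m _ => ?_
  rw [fwdDiff_iter_gbinom, mrrTerm_eq_mrrWeight_mul hX]
  congr 1
  refine if_congr (by omega) ?_ rfl
  rw [show 2 * k + 1 - (m + 2) = 2 * k - (m + 1) by omega, hμ]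
  congr 1
  push_cast
  ring

lemma weightFunctional_columnPoly {μ X : ℂ} (hμ : μ = 2 * X - 1) (hX : ∀ z : ℤ, 2 * X ≠ z)
    {N : ℕ} (hN : 1 ≤ N) {j : ℕ} (hj : j ≤ 2 * N + 1) :
    weightFunctional (diffWeight (mrrWeight X N) N) (2 * N + 3) (columnPoly μ j)
      = if j = 2 * N + 1 then 2 * mrrVal X N else 0 := by
  obtain ⟨h0, h1⟩ := mrrSum_eval N hN X hX
  have hlead : ∀ k : ℕ, (gbinomPoly ((μ - 1) / 2 + k) (2 * k + 1)).coeff (2 * k + 1) ≠ 0 :=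
    fun k => by
      rw [coeff_gbinomPoly]
      exact inv_ne_zero (Nat.cast_ne_zero.2 (Nat.factorial_ne_zero _))
  have hdeg := fun k : ℕ => (natDegree_gbinomPoly ((μ - 1) / 2 + k) (2 * k + 1)).le
  have hL : ∀ k < N, weightFunctional (diffWeight (mrrWeight X N) N) (2 * N + 3)
      (gbinomPoly ((μ - 1) / 2 + k) (2 * k + 1)) = 0 := fun k hk => by
    rw [weightFunctional_gbinomPoly hμ hX, h0 k hk]
  split_ifs with h
  · subst h
    rw [functional_top_of_odd (gbinomPoly_odd μ) hdeg hlead hL 2 _ (columnPoly_odd μ _)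
      (natDegree_columnPoly_le μ _) (by rw [coeff_columnPoly, coeff_gbinomPoly]),
      weightFunctional_gbinomPoly hμ hX, h1]
  · exact functional_eq_zero_of_odd (gbinomPoly_odd μ) hdeg hlead hL N le_rfl _
      (columnPoly_odd μ _) ((natDegree_columnPoly_le μ _).trans (by omega))

/-- If a row vector `v` is mapped by the matrix of `bdet μ (m + 1) 1 0` to a multiple of the last
basis vector, then consecutive determinants are proportional. -/
lemma bdet_succ_mul_of_vecMul {μ : ℂ} {m : ℕ} {v : Fin (m + 1) → ℂ} {c : ℂ}
    (h : ∀ j : Fin (m + 1), ∑ i, v i * ((if 1 + i.1 = 0 + j.1 then (-1 : ℂ) else 0)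
      + gbinom (μ + ((1 + i.1 : ℕ) : ℂ) + ((0 + j.1 : ℕ) : ℂ) - 2) (0 + j.1))
      = if j = Fin.last m then c else 0) :
    bdet μ (m + 1) 1 0 * v (Fin.last m) = c * bdet μ m 1 0 := by
  set A : Matrix (Fin (m + 1)) (Fin (m + 1)) ℂ := Matrix.of fun i j =>
    (if 1 + i.1 = 0 + j.1 then (-1 : ℂ) else 0)
      + gbinom (μ + ((1 + i.1 : ℕ) : ℂ) + ((0 + j.1 : ℕ) : ℂ) - 2) (0 + j.1) with hA
  have hv : Matrix.vecMul v A = fun j => if j = Fin.last m then c else 0 := funext h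
  have h1 : Matrix.vecMul (Matrix.vecMul v A) A.adjugate = A.det • v := by
    rw [Matrix.vecMul_vecMul, Matrix.mul_adjugate, Matrix.vecMul_smul, Matrix.vecMul_one]
  have h2 := congrFun h1 (Fin.last m)
  rw [hv, Matrix.vecMul, dotProduct] at h2
  simp only [ite_mul, zero_mul, Finset.sum_ite_eq', Finset.mem_univ, if_true,
    Pi.smul_apply, smul_eq_mul] at h2
  rw [Matrix.adjugate_fin_succ_eq_det_submatrix, Fin.succAbove_last, Even.neg_one_pow ⟨_, rfl⟩,
    one_mul] at h2
  exact h2.symm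

lemma bdet_quotient_mrr {μ X : ℂ} (hμ : μ = 2 * X - 1) (hX : ∀ z : ℤ, 2 * X ≠ z)
    {N : ℕ} (hN : 1 ≤ N) :
    bdet μ (2 * N + 2) 1 0 * mrrWeight X N N = 2 * mrrVal X N * bdet μ (2 * N + 1) 1 0 := by
  set w := diffWeight (mrrWeight X N) N with hw
  have key := bdet_succ_mul_of_vecMul (μ := μ) (m := 2 * N + 1)
    (v := fun i => w (i.1 + 1)) (c := 2 * mrrVal X N) fun j => ?_
  · rwa [Fin.val_last, hw, diffWeight_last _ _ hN] at key
  have hj := weightFunctional_columnPoly hμ hX hN (show j.1 ≤ 2 * N + 1 by omega)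
  rw [weightFunctional_apply] at hj
  simp only [eval_columnPoly, mul_sub, Finset.sum_sub_distrib] at hj
  rw [sum_diffWeight_mul_gbinom, ← hw, Finset.sum_range_succ', hw, diffWeight_zero, ← hw, zero_mul,
    add_zero] at hj
  have hs : w j.1 = ∑ i ∈ Finset.range (2 * N + 2), if i + 1 = j.1 then w (i + 1) else 0 := by
    have : (∑ i ∈ Finset.range (2 * N + 3), if i = j.1 then w i else 0) = w j.1 := by
      rw [Finset.sum_ite_eq', if_pos (Finset.mem_range.2 (by omega))]
    rw [← this, Finset.sum_range_succ', hw, diffWeight_zero]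
    simp
  rw [hs, ← Finset.sum_sub_distrib] at hj
  rw [show (if j = Fin.last (2 * N + 1) then 2 * mrrVal X N else 0)
    = if j.1 = 2 * N + 1 then 2 * mrrVal X N else 0 from if_congr Fin.ext_iff rfl rfl, ← hj,
    ← Fin.sum_univ_eq_sum_range fun i => w (i + 1) * gbinom (((i + 1 : ℕ) : ℂ) + (μ - 2 + j.1)) j.1
      - if i + 1 = j.1 then w (i + 1) else 0]
  refine Finset.sum_congr rfl fun i _ => ?_
  simp only [zero_add, add_comm 1 i.1]
  rw [show μ + ((i.1 + 1 : ℕ) : ℂ) + (j.1 : ℂ) - 2 = ((i.1 + 1 : ℕ) : ℂ) + (μ - 2 + j.1) by ring]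
  split_ifs <;> ring

lemma Gamma_natCast_ne_zero {N : ℕ} (hN : 1 ≤ N) : Gamma (N : ℂ) ≠ 0 :=
  Complex.Gamma_ne_zero fun m hm => by
    have : N + m = 0 := by exact_mod_cast (by linear_combination hm : (N : ℂ) + m = 0)
    omega

lemma mrrVal_mul_poch {X : ℂ} (hX : ∀ z : ℤ, 2 * X ≠ z) {N : ℕ} (hN : 1 ≤ N) :
    mrrVal X N * poch (N + 1) N * poch (X + N + 3 / 2) N
      = mrrWeight X N N * poch (X + 2 * N + 1 / 2) N * poch (2 * X + 2 * N + 2) N := by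
  have hne {s : ℂ} (z : ℤ) (h : 2 * s = 2 * X + z) (i : ℕ) : s + i ≠ 0 :=
    ne_zero_of_generic hX (z + 2 * i) (by push_cast; linear_combination h)
  have p1 := poch_mul_Gamma (x := (N : ℂ) + 1) (fun i => by
    exact_mod_cast (by omega : N + 1 + i ≠ 0)) N
  have p2 := poch_mul_Gamma (hne (s := X + N + 3 / 2) (2 * N + 3) (by push_cast; ring)) N
  have p3 := poch_mul_Gamma (hne (s := X + 2 * N + 1 / 2) (4 * N + 1) (by push_cast; ring)) N
  have p4 := poch_mul_Gamma (x := 2 * X + 2 * N + 2)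
    (fun i h => hX (-(2 * N + 2 + i)) (by push_cast; linear_combination h)) N
  have n2 : Gamma (X + 2 * N + 3 / 2) ≠ 0 :=
    Gamma_ne_zero_of_generic hX (4 * N + 3) (by push_cast; ring)
  have n4 : Gamma (2 * X + 2 * N + 2) ≠ 0 := Complex.Gamma_ne_zero fun m hm =>
    hX (-(2 * N + 2 + m)) (by push_cast; linear_combination hm)
  have n5 : Gamma (2 * X + 2 * N + N + 2) ≠ 0 := Complex.Gamma_ne_zero fun m hm =>
    hX (-(3 * N + 2 + m)) (by push_cast; linear_combination hm)
  have n6 := Gamma_natCast_ne_zero hN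
  have n7 : ((2 * N).factorial : ℂ) ≠ 0 := Nat.cast_ne_zero.2 (Nat.factorial_ne_zero _)
  rw [Complex.Gamma_nat_eq_factorial, show (N : ℂ) + 1 + N = (2 * N : ℕ) + 1 by push_cast; ring,
    Complex.Gamma_nat_eq_factorial] at p1
  rw [show X + N + 3 / 2 + N = X + 2 * N + 3 / 2 by ring] at p2
  rw [show X + 2 * N + 1 / 2 + N = X + 3 * N + 1 / 2 by ring] at p3
  rw [show 2 * X + 2 * N + 2 + N = 2 * X + 2 * N + N + 2 by ring] at p4
  unfold mrrVal mrrWeight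
  rw [show (N : ℂ) - N + 1 = 1 by ring, Complex.Gamma_one, show 2 * (N : ℂ) - N = N by ring,
    show X + N + N + 1 / 2 = X + 2 * N + 1 / 2 by ring]
  calc _ = (-4) ^ N * Gamma (X + N + 1) * Gamma (X + 3 * N + 1 / 2)
        * (poch (N + 1) N * N.factorial) * (poch (X + N + 3 / 2) N * Gamma (X + N + 3 / 2))
        * (Gamma (2 * X + 2 * N + 2))⁻¹ * ((2 * N).factorial : ℂ)⁻¹
        * (Gamma (X + 2 * N + 3 / 2))⁻¹ := by ring
    _ = (-4) ^ N * Gamma (X + N + 1) * Gamma (X + 3 * N + 1 / 2)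
        * (Gamma (2 * X + 2 * N + 2))⁻¹ := by
      rw [p1, p2]
      generalize Gamma (X + 2 * N + 3 / 2) = G at n2 ⊢
      field_simp
    _ = (-4) ^ N * Gamma (X + N + 1) * (poch (X + 2 * N + 1 / 2) N * Gamma (X + 2 * N + 1 / 2))
        * (poch (2 * X + 2 * N + 2) N * Gamma (2 * X + 2 * N + 2))
        * (Gamma (2 * X + 2 * N + N + 2))⁻¹ * (Gamma (2 * X + 2 * N + 2))⁻¹ := by
      rw [p3, p4]
      generalize Gamma (2 * X + 2 * N + N + 2) = G at n5 ⊢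
      field_simp
    _ = _ := by
      generalize Gamma (2 * X + 2 * N + 2) = G at n4 ⊢
      field_simp

lemma mrrWeight_ne_zero {X : ℂ} (hX : ∀ z : ℤ, 2 * X ≠ z) {N : ℕ} (hN : 1 ≤ N) :
    mrrWeight X N N ≠ 0 := by
  have n6 := Gamma_natCast_ne_zero hN
  have n5 : Gamma (2 * X + 2 * N + N + 2) ≠ 0 := Complex.Gamma_ne_zero fun m hm =>
    hX (-(3 * N + 2 + m)) (by push_cast; linear_combination hm)
  have n1 : Gamma (X + N + 1) ≠ 0 :=
    Gamma_ne_zero_of_generic hX (2 * N + 2) (by push_cast; ring)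
  have n2 : Gamma (X + N + N + 1 / 2) ≠ 0 :=
    Gamma_ne_zero_of_generic hX (4 * N + 1) (by push_cast; ring)
  unfold mrrWeight
  rw [show (N : ℂ) - N + 1 = 1 by ring, Complex.Gamma_one, show 2 * (N : ℂ) - N = N by ring]
  generalize Gamma (X + N + N + 1 / 2) = G at n2 ⊢
  simp [n1, n2, n5, n6]

/-- The quotient formula when `μ` is not an integer. -/
lemma bdet_quotient_of_generic {μ : ℂ} (hμ : ∀ z : ℤ, μ ≠ z) {N : ℕ} (hN : 1 ≤ N) :
    bdet μ (2 * N + 2) 1 0 * poch (N + 1) N * poch (μ / 2 + (N + 1) + 1) N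
      = 2 * poch (μ / 2 + 2 * (N + 1) - 1) N * poch (μ + 2 * (N + 1) + 1) N
        * bdet μ (2 * N + 1) 1 0 := by
  obtain ⟨X, rfl⟩ : ∃ X, μ = 2 * X - 1 := ⟨(μ + 1) / 2, by ring⟩
  have hX : ∀ z : ℤ, 2 * X ≠ z := fun z h => hμ (z - 1) (by rw [h]; push_cast; rfl)
  have h1 := bdet_quotient_mrr rfl hX hN
  have h2 := mrrVal_mul_poch hX hN
  refine mul_right_cancel₀ (mrrWeight_ne_zero hX hN) ?_
  rw [show (2 * X - 1) / 2 + ((N : ℂ) + 1) + 1 = X + N + 3 / 2 by ring,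
    show (2 * X - 1) / 2 + 2 * ((N : ℂ) + 1) - 1 = X + 2 * N + 1 / 2 by ring,
    show 2 * X - 1 + 2 * ((N : ℂ) + 1) + 1 = 2 * X + 2 * N + 2 by ring]
  linear_combination poch (N + 1) N * poch (X + N + 3 / 2) N * h1
    + 2 * bdet (2 * X - 1) (2 * N + 1) 1 0 * h2

lemma exists_polynomial_bdet (n I J : ℕ) :
    ∃ P : Polynomial ℂ, ∀ μ, P.eval μ = bdet μ n I J := by
  refine ⟨Matrix.det (Matrix.of fun i j : Fin n =>
    Polynomial.C (if I + i.1 = J + j.1 then (-1 : ℂ) else 0)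
      + gbinomPoly (((I + i.1 : ℕ) : ℂ) + ((J + j.1 : ℕ) : ℂ) - 2) (J + j.1)), fun μ => ?_⟩
  rw [← Polynomial.coe_evalRingHom, RingHom.map_det, bdet]
  congr 1
  ext i j
  simp only [RingHom.mapMatrix_apply, Matrix.map_apply, Matrix.of_apply,
    Polynomial.coe_evalRingHom, Polynomial.eval_add, Polynomial.eval_C, eval_gbinomPoly]
  congr 2
  ring

lemma exists_polynomial_poch (a b : ℂ) (k : ℕ) :
    ∃ P : Polynomial ℂ, ∀ μ, P.eval μ = poch (a * μ + b) k := by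
  refine ⟨∏ i ∈ Finset.range k, (Polynomial.C a * Polynomial.X + Polynomial.C (b + i)),
    fun μ => ?_⟩
  rw [Polynomial.eval_prod, poch]
  refine Finset.prod_congr rfl fun i _ => ?_
  simp only [Polynomial.eval_add, Polynomial.eval_mul, Polynomial.eval_C, Polynomial.eval_X]
  ring

lemma polynomial_eq_of_generic {P Q : Polynomial ℂ}
    (h : ∀ μ : ℂ, (∀ z : ℤ, μ ≠ z) → P.eval μ = Q.eval μ) : P = Q := by
  refine Polynomial.eq_of_infinite_eval_eq P Q (Set.Infinite.mono (s := Set.range fun t : ℕ =>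
    (t : ℂ) + 1 / 2) ?_ (Set.infinite_range_of_injective fun s t hst => by simpa using hst))
  rintro _ ⟨t, rfl⟩
  refine h _ fun z hz => ?_
  have : 2 * (t : ℤ) + 1 = 2 * z := by
    exact_mod_cast (by linear_combination 2 * hz : 2 * (t : ℂ) + 1 = 2 * z)
  omega

lemma bdet_one (μ : ℂ) : bdet μ 1 1 0 = 1 := by
  simp [bdet, gbinom]

lemma bdet_two (μ : ℂ) : bdet μ 2 1 0 = 2 := by
  simp [bdet, gbinom, Matrix.det_fin_two]
  ring

end

/-- The quotient `Q4(n) = b_{2n}(1,0)/b_{2n-1}(1,0)` (cleared form). -/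
theorem quotient_Q4 (μ : ℂ) (n : ℕ) (hn : 1 ≤ n) :
    bdet μ (2 * n) 1 0 * poch (n : ℂ) (n - 1) * poch (μ / 2 + n + 1) (n - 1)
      = 2 * poch (μ / 2 + 2 * n - 1) (n - 1) * poch (μ + 2 * n + 1) (n - 1)
        * bdet μ (2 * n - 1) 1 0 := by
  obtain ⟨N, rfl⟩ := Nat.exists_eq_add_of_le' hn
  rw [show 2 * (N + 1) = 2 * N + 2 by ring, show 2 * N + 2 - 1 = 2 * N + 1 by omega,
    Nat.add_sub_cancel]
  rcases Nat.eq_zero_or_pos N with rfl | hN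
  · simp [bdet_one, bdet_two, poch]
  obtain ⟨P, hP⟩ := exists_polynomial_bdet (2 * N + 2) 1 0
  obtain ⟨Q, hQ⟩ := exists_polynomial_bdet (2 * N + 1) 1 0
  obtain ⟨R, hR⟩ := exists_polynomial_poch (1 / 2) ((N : ℂ) + 1 + 1) N
  obtain ⟨S, hS⟩ := exists_polynomial_poch (1 / 2) (2 * ((N : ℂ) + 1) - 1) N
  obtain ⟨T, hT⟩ := exists_polynomial_poch 1 (2 * ((N : ℂ) + 1) + 1) N
  have e1 (μ : ℂ) : 1 / 2 * μ + ((N : ℂ) + 1 + 1) = μ / 2 + (N + 1) + 1 := by ring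
  have e2 (μ : ℂ) : 1 / 2 * μ + (2 * ((N : ℂ) + 1) - 1) = μ / 2 + 2 * (N + 1) - 1 := by ring
  have e3 (μ : ℂ) : 1 * μ + (2 * ((N : ℂ) + 1) + 1) = μ + 2 * (N + 1) + 1 := by ring
  have h : P * Polynomial.C (poch (N + 1) N) * R = Polynomial.C 2 * S * T * Q := by
    refine polynomial_eq_of_generic fun ν hν => ?_
    simp only [Polynomial.eval_mul, Polynomial.eval_C, hP, hQ, hR, hS, hT, e1, e2, e3]
    exact bdet_quotient_of_generic hν hN
  have h := congrArg (Polynomial.eval μ) h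
  simp only [Polynomial.eval_mul, Polynomial.eval_C, hP, hQ, hR, hS, hT, e1, e2, e3] at h
  push_cast
  exact h
end
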